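/- Let 2 < p < ∞, q = p/(p−1), let n ≤ N be positive integers with n ≥ 2, let X be a finite-dimensional Banach space, Y a Banach space with dim(Y) ≤ n, and u : X → Y a linear operator. Then there is a constant C_p depending only on p (which can be taken of the form C p^2 2^{p/2} with C absolute) such that ν_q^{(⌈7N/8⌉, 2)}(u) ≤ (1 + C_p (n^{p/2}/N)^{1/2} (log n) (log N)^{1/2}) · ν_q^{(N, 1)}(u). -/

import Mathlib

open scoped BigOperators

/-- The sup norm on `Fin k → ℝ` (the norm of `ℓ_∞^k`). -/
noncomputable def supNormFin {k : ℕ} (x : Fin k → ℝ) : ℝ :=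
  sSup (Set.range fun i => |x i|)

/-- The `ℓ_q^k` norm on `Fin k → ℝ`. -/
noncomputable def lqNormFin (q : ℝ) {k : ℕ} (x : Fin k → ℝ) : ℝ :=
  (∑ i, |x i| ^ q) ^ (1 / q)

/-- `ν_q^{(k)}(v)`: the infimum of `‖A‖·‖w‖·‖B‖` over all factorizations `v = B w A`
where `A : X → ℓ_∞^k`, `w : ℓ_∞^k → ℓ_q^k` is a diagonal operator with entries `d`,
and `B : ℓ_q^k → Y`; the three operator norms are computed with respect to the
indicated norms. -/
noncomputable def nuQ (q : ℝ) (k : ℕ) {X Y : Type*} [NormedAddCommGroup X]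
    [NormedSpace ℝ X] [NormedAddCommGroup Y] [NormedSpace ℝ Y] (v : X →ₗ[ℝ] Y) : ℝ :=
  sInf { r : ℝ | ∃ (A : X →ₗ[ℝ] (Fin k → ℝ)) (d : Fin k → ℝ) (B : (Fin k → ℝ) →ₗ[ℝ] Y),
    v = B ∘ₗ (LinearMap.pi fun i => d i • LinearMap.proj i) ∘ₗ A ∧
    r = sSup {a | ∃ x : X, ‖x‖ ≤ 1 ∧ a = supNormFin (A x)} *
        sSup {a | ∃ x : Fin k → ℝ, supNormFin x ≤ 1 ∧ a = lqNormFin q fun i => d i * x i} *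
        sSup {a | ∃ x : Fin k → ℝ, lqNormFin q x ≤ 1 ∧ a = ‖B x‖} }

/-- `ν_q^{(k,m)}(v) = inf { ∑_{i=1}^m ν_q^{(k)}(v_i) : v = ∑_{i=1}^m v_i }`. -/
noncomputable def nuQSplit (q : ℝ) (k m : ℕ) {X Y : Type*} [NormedAddCommGroup X]
    [NormedSpace ℝ X] [NormedAddCommGroup Y] [NormedSpace ℝ Y] (v : X →ₗ[ℝ] Y) : ℝ :=
  sInf { r : ℝ | ∃ u : Fin m → (X →ₗ[ℝ] Y), v = ∑ i, u i ∧ r = ∑ i, nuQ q k (u i) }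

/-- The sign `±1` attached to a Boolean. -/
def signOf (b : Bool) : ℝ := if b then 1 else -1

theorem sum_exp_signs_le {N : ℕ} (v : Fin N → ℝ) :
    ∑ b : Fin N → Bool, Real.exp (∑ i, signOf (b i) * v i) ≤
      2 ^ N * Real.exp ((∑ i, v i ^ 2) / 2) := by
  have h : ∑ b : Fin N → Bool, Real.exp (∑ i, signOf (b i) * v i) =
      ∏ i, ∑ b : Bool, Real.exp (signOf b * v i) := by
    rw [Finset.prod_univ_sum]
    simp only [Real.exp_sum, Fintype.piFinset_univ]
  rw [h, Finset.sum_div, Real.exp_sum]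
  have h2 : (2 : ℝ) ^ N = ∏ _i : Fin N, (2 : ℝ) := by simp
  rw [h2, ← Finset.prod_mul_distrib]
  refine Finset.prod_le_prod (fun i _ => by positivity) fun i _ => ?_
  have h3 := Real.cosh_le_exp_half_sq (v i)
  rw [Real.cosh_eq] at h3
  simp only [signOf, Fintype.sum_bool, if_true, Bool.false_eq_true, if_false, one_mul, neg_one_mul]
  linarith

theorem card_large_signed_sum_le {N : ℕ} (v : Fin N → ℝ) {σ L : ℝ} (hσ : 0 ≤ σ) (hL : 0 ≤ L)
    (hv : ∑ i, v i ^ 2 ≤ σ ^ 2) :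
    ((Finset.univ.filter fun b : Fin N → Bool =>
      σ * √(2 * L) < |∑ i, signOf (b i) * v i|).card : ℝ) ≤ 2 ^ N * (2 * Real.exp (-L)) := by
  rcases hσ.eq_or_lt with rfl | hσ'
  · have hv0 : ∀ i, v i = 0 := by
      intro i
      have := Finset.single_le_sum (f := fun i => v i ^ 2) (fun i _ => sq_nonneg _)
        (Finset.mem_univ i)
      have h0 : v i ^ 2 ≤ 0 := by simpa using this.trans hv
      exact pow_eq_zero_iff (two_ne_zero) |>.1 (le_antisymm h0 (sq_nonneg _))
    simp only [hv0]
    simp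
    positivity
  · set t := √(2 * L) / σ with ht
    have ht0 : 0 ≤ t := by positivity
    have htσ : t * σ = √(2 * L) := by rw [ht]; field_simp
    have hsq : √(2 * L) ^ 2 = 2 * L := Real.sq_sqrt (by positivity)
    have key : ∀ s : ℝ, s = 1 ∨ s = -1 →
        ∑ b : Fin N → Bool, Real.exp (s * t * ∑ i, signOf (b i) * v i) ≤
          2 ^ N * Real.exp L := by
      intro s hs
      have h := sum_exp_signs_le (fun i => s * t * v i)
      have e : ∀ b : Fin N → Bool, s * t * ∑ i, signOf (b i) * v i =
          ∑ i, signOf (b i) * (s * t * v i) := by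
        intro b
        rw [Finset.mul_sum]
        exact Finset.sum_congr rfl fun i _ => by ring
      simp only [e]
      refine h.trans ?_
      gcongr
      have hs2 : s ^ 2 = 1 := by rcases hs with rfl | rfl <;> norm_num
      have : ∑ i, (s * t * v i) ^ 2 = t ^ 2 * ∑ i, v i ^ 2 := by
        rw [Finset.mul_sum]
        refine Finset.sum_congr rfl fun i _ => ?_
        rw [mul_pow, mul_pow, hs2, one_mul]
      rw [this]
      have : t ^ 2 * ∑ i, v i ^ 2 ≤ t ^ 2 * σ ^ 2 := by gcongr
      have : t ^ 2 * σ ^ 2 = 2 * L := by rw [← mul_pow, htσ, hsq]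
      linarith
    have h1 := key 1 (Or.inl rfl)
    have h2 := key (-1) (Or.inr rfl)
    have hcard : ((Finset.univ.filter fun b : Fin N → Bool =>
        σ * √(2 * L) < |∑ i, signOf (b i) * v i|).card : ℝ) * Real.exp (2 * L) ≤
        ∑ b : Fin N → Bool, (Real.exp (1 * t * ∑ i, signOf (b i) * v i) +
          Real.exp (-1 * t * ∑ i, signOf (b i) * v i)) := by
      rw [← nsmul_eq_mul, ← Finset.sum_const]
      refine (Finset.sum_le_sum fun b hb => ?_).trans
        (Finset.sum_le_sum_of_subset_of_nonneg (Finset.filter_subset _ _)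
          fun b _ _ => by positivity)
      have hb' := (Finset.mem_filter.1 hb).2
      have hbt : 2 * L ≤ t * |∑ i, signOf (b i) * v i| := by
        calc 2 * L = t * (σ * √(2 * L)) := by rw [← mul_assoc, htσ, ← sq, hsq]
          _ ≤ _ := by gcongr
      rcases abs_cases (∑ i, signOf (b i) * v i) with ⟨ha, _⟩ | ⟨ha, _⟩ <;> rw [ha] at hbt
      · have : Real.exp (2 * L) ≤ Real.exp (1 * t * ∑ i, signOf (b i) * v i) :=
          Real.exp_le_exp.2 (by linarith)
        have := Real.exp_pos (-1 * t * ∑ i, signOf (b i) * v i)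
        linarith
      · have : Real.exp (2 * L) ≤ Real.exp (-1 * t * ∑ i, signOf (b i) * v i) :=
          Real.exp_le_exp.2 (by linarith)
        have := Real.exp_pos (1 * t * ∑ i, signOf (b i) * v i)
        linarith
    rw [Finset.sum_add_distrib] at hcard
    have h4 : Real.exp L = Real.exp (2 * L) * Real.exp (-L) := by
      rw [← Real.exp_add]; congr 1; ring
    refine le_of_mul_le_mul_right ?_ (Real.exp_pos (2 * L))
    calc _ ≤ _ := hcard
      _ ≤ 2 ^ N * Real.exp L + 2 ^ N * Real.exp L := add_le_add h1 h2
      _ = _ := by rw [h4]; ring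

theorem exists_signs_forall_abs_le {N M : ℕ} (U : ℕ → Finset (Fin N → ℝ)) (σ L : ℕ → ℝ)
    (hσ : ∀ k, 0 ≤ σ k) (hL : ∀ k, 0 ≤ L k)
    (hU : ∀ k < M, ∀ v ∈ U k, ∑ i, v i ^ 2 ≤ σ k ^ 2)
    (hsum : ∑ k ∈ Finset.range M, ((U k).card : ℝ) * (2 * Real.exp (-L k)) < 1) :
    ∃ ε : Fin N → ℝ, (∀ i, ε i = 1 ∨ ε i = -1) ∧
      ∀ k < M, ∀ v ∈ U k, |∑ i, ε i * v i| ≤ σ k * √(2 * L k) := by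
  by_contra! hcon
  have hbad : ∀ b : Fin N → Bool, ∃ k < M, ∃ v ∈ U k,
      σ k * √(2 * L k) < |∑ i, signOf (b i) * v i| := fun b =>
    hcon (fun i => signOf (b i)) fun i => by cases h : b i <;> simp [signOf]
  have hcover : (Finset.univ : Finset (Fin N → Bool)) ⊆ (Finset.range M).biUnion fun k =>
      (U k).biUnion fun v => Finset.univ.filter fun b : Fin N → Bool =>
        σ k * √(2 * L k) < |∑ i, signOf (b i) * v i| := by
    intro b _
    obtain ⟨k, hk, v, hv, h⟩ := hbad b
    simp only [Finset.mem_biUnion, Finset.mem_range, Finset.mem_filter, Finset.mem_univ, true_and]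
    exact ⟨k, hk, v, hv, h⟩
  have hc := (Finset.card_le_card hcover).trans
    (Finset.card_biUnion_le.trans (Finset.sum_le_sum fun k _ => Finset.card_biUnion_le))
  have hc' : ((2 : ℝ) ^ N) ≤ ∑ k ∈ Finset.range M, ∑ v ∈ U k,
      ((Finset.univ.filter fun b : Fin N → Bool =>
        σ k * √(2 * L k) < |∑ i, signOf (b i) * v i|).card : ℝ) := by
    have : Fintype.card (Fin N → Bool) = 2 ^ N := by simp
    rw [Finset.card_univ, this] at hc
    exact_mod_cast hc
  have : ∑ k ∈ Finset.range M, ∑ v ∈ U k,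
      ((Finset.univ.filter fun b : Fin N → Bool =>
        σ k * √(2 * L k) < |∑ i, signOf (b i) * v i|).card : ℝ) ≤
      2 ^ N * ∑ k ∈ Finset.range M, ((U k).card : ℝ) * (2 * Real.exp (-L k)) := by
    rw [Finset.mul_sum]
    refine Finset.sum_le_sum fun k hk => ?_
    calc _ ≤ ∑ v ∈ U k, (2 : ℝ) ^ N * (2 * Real.exp (-L k)) :=
          Finset.sum_le_sum fun v hv =>
            card_large_signed_sum_le v (hσ k) (hL k) (hU k (Finset.mem_range.1 hk) v hv)
      _ = _ := by rw [Finset.sum_const, nsmul_eq_mul]; ring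
  have h2 : (0 : ℝ) < 2 ^ N := by positivity
  nlinarith

/-- Greedy covering: a ball of radius `ε √T` is covered, at scale `ε` for the seminorm
`max_i |⟪x, y i⟫|`, by `(2 N + 1) ^ T` points. -/
theorem exists_greedy_net {N : ℕ} {V : Type*} [NormedAddCommGroup V] [InnerProductSpace ℝ V]
    (y : Fin N → V) (hy : ∀ i, ‖y i‖ ≤ 1) {ε : ℝ} (hε : 0 < ε) (T : ℕ) :
    ∃ Z : Finset V, Z.card ≤ (2 * N + 1) ^ T ∧ 0 ∈ Z ∧
      ∀ x : V, ‖x‖ ^ 2 ≤ T * ε ^ 2 → ∃ z ∈ Z, ∀ i, |inner ℝ (x - z) (y i)| ≤ ε := by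
  classical
  induction T with
  | zero =>
    refine ⟨{0}, by simp, by simp, fun x hx => ⟨0, by simp, fun i => ?_⟩⟩
    have : x = 0 := by
      have h0 : ‖x‖ ^ 2 ≤ 0 := by simpa using hx
      exact norm_eq_zero.1 (pow_eq_zero_iff two_ne_zero |>.1 (le_antisymm h0 (sq_nonneg _)))
    simp [this, hε.le]
  | succ T ih =>
    obtain ⟨Z, hZ, hZ0, hcov⟩ := ih
    let g : Option (Fin N × Bool) → V := fun o => o.elim 0 fun c => (signOf c.2 * ε) • y c.1
    refine ⟨(Finset.univ ×ˢ Z).image fun c => g c.1 + c.2, ?_, ?_, fun x hx => ?_⟩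
    · refine Finset.card_image_le.trans ?_
      rw [Finset.card_product, pow_succ, mul_comm]
      refine Nat.mul_le_mul hZ (le_of_eq ?_)
      simp [Fintype.card_option, mul_comm]
    · exact Finset.mem_image.2 ⟨(none, 0), by simp [hZ0], by simp [g]⟩
    · by_cases h : ∀ i, |inner ℝ x (y i)| ≤ ε
      · exact ⟨0, Finset.mem_image.2 ⟨(none, 0), by simp [hZ0], by simp [g]⟩, by simpa using h⟩
      · push Not at h
        obtain ⟨i, hi⟩ := h
        obtain ⟨b, hb⟩ : ∃ b : Bool, signOf b * inner ℝ x (y i) = |inner ℝ x (y i)| := by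
          rcases abs_cases (inner ℝ x (y i)) with ⟨ha, _⟩ | ⟨ha, _⟩
          · exact ⟨true, by simp [signOf, ha]⟩
          · exact ⟨false, by simp [signOf, ha]⟩
        have hs : signOf b ^ 2 = 1 := by cases b <;> simp [signOf]
        have hx' : ‖x - (signOf b * ε) • y i‖ ^ 2 ≤ T * ε ^ 2 := by
          rw [norm_sub_sq_real, inner_smul_right, norm_smul, mul_pow, Real.norm_eq_abs, sq_abs,
            mul_pow, hs, one_mul]
          have h1 : ‖y i‖ ^ 2 ≤ 1 := by
            have := hy i; have := norm_nonneg (y i); nlinarith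
          have h2 : ε ^ 2 * ‖y i‖ ^ 2 ≤ ε ^ 2 := by nlinarith [sq_nonneg ε]
          have h3 : signOf b * ε * inner ℝ x (y i) = ε * |inner ℝ x (y i)| := by
            rw [← hb]; ring
          rw [h3]
          push_cast at hx
          nlinarith
        obtain ⟨z, hz, hzx⟩ := hcov _ hx'
        refine ⟨(signOf b * ε) • y i + z,
          Finset.mem_image.2 ⟨(some (i, b), z), by simp [hz], by simp [g]⟩, fun j => ?_⟩
        rw [← sub_sub]
        exact hzx j

/-- Coordinatewise rounding. -/
theorem exists_grid_net {r : ℕ} (M : ℕ) (hM : 0 < M) :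
    ∃ Z : Finset (EuclideanSpace ℝ (Fin r)), Z.card ≤ (2 * M + 1) ^ r ∧
      ∀ x : EuclideanSpace ℝ (Fin r), ‖x‖ ≤ 1 → ∃ z ∈ Z, ‖x - z‖ ≤ √r / M := by
  classical
  have hM' : (0 : ℝ) < M := by exact_mod_cast hM
  let g : (Fin r → ℤ) → EuclideanSpace ℝ (Fin r) := fun k => WithLp.toLp 2 fun j => (k j : ℝ) / M
  refine ⟨(Fintype.piFinset fun _ : Fin r => Finset.Icc (-(M : ℤ)) M).image g, ?_, fun x hx => ?_⟩
  · refine Finset.card_image_le.trans (le_of_eq ?_)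
    rw [Fintype.card_piFinset_const, Int.card_Icc]
    congr 1
    omega
  · have hxj : ∀ j, |x j| ≤ 1 := fun j => by
      have := (PiLp.norm_apply_le x j).trans hx
      simpa using this
    refine ⟨g fun j => ⌊x j * M⌋, Finset.mem_image_of_mem _ ?_, ?_⟩
    · rw [Fintype.mem_piFinset]
      intro j
      have h := abs_le.1 (hxj j)
      rw [Finset.mem_Icc]
      constructor
      · rw [Int.le_floor]
        push_cast
        nlinarith
      · have : ((⌊x j * M⌋ : ℤ) : ℝ) ≤ M := (Int.floor_le _).trans (by nlinarith)
        exact_mod_cast this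
    · rw [EuclideanSpace.norm_eq]
      have hb : ∀ j, ‖(x - g fun j => ⌊x j * M⌋) j‖ ^ 2 ≤ (1 / M : ℝ) ^ 2 := by
        intro j
        have e : (x - g fun j => ⌊x j * M⌋) j = (x j * M - ⌊x j * M⌋) / M := by
          simp only [g, PiLp.sub_apply]
          field_simp
        rw [e, Real.norm_eq_abs, sq_abs, div_pow, div_pow]
        have h1 := Int.floor_le (x j * M)
        have h2 := Int.lt_floor_add_one (x j * M)
        gcongr
        all_goals linarith
      calc _ ≤ √(∑ _j : Fin r, (1 / M : ℝ) ^ 2) :=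
            Real.sqrt_le_sqrt (Finset.sum_le_sum fun j _ => hb j)
        _ = √r / M := by
            rw [Finset.sum_const, Finset.card_univ, Fintype.card_fin, nsmul_eq_mul,
              Real.sqrt_mul (by positivity), Real.sqrt_sq (by positivity)]
            ring

theorem exists_grid_net_of_finrank {E : Type*} [NormedAddCommGroup E] [InnerProductSpace ℝ E]
    [FiniteDimensional ℝ E] {r : ℕ} (hfin : Module.finrank ℝ E = r) (M : ℕ) (hM : 0 < M) :
    ∃ Z : Finset E, Z.card ≤ (2 * M + 1) ^ r ∧ ∀ x : E, ‖x‖ ≤ 1 → ∃ z ∈ Z, ‖x - z‖ ≤ √r / M := by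
  classical
  subst hfin
  obtain ⟨Z, hZ, hcov⟩ := exists_grid_net (r := Module.finrank ℝ E) M hM
  let e := (stdOrthonormalBasis ℝ E).repr
  refine ⟨Z.image e.symm, Finset.card_image_le.trans hZ, fun x hx => ?_⟩
  obtain ⟨z, hz, h⟩ := hcov (e x) (by rwa [e.norm_map])
  refine ⟨e.symm z, Finset.mem_image_of_mem _ hz, ?_⟩
  rwa [← e.norm_map, map_sub, e.apply_symm_apply]

/-- A covering can be replaced by one with centres in the covered set, at twice the scale. -/
theorem exists_net_subset {N : ℕ} {V : Type*} [NormedAddCommGroup V] [InnerProductSpace ℝ V]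
    (y : Fin N → V) (B : Set V) (Z : Finset V) {s : ℝ}
    (hcov : ∀ x ∈ B, ∃ z ∈ Z, ∀ i, |inner ℝ (x - z) (y i)| ≤ s) :
    ∃ A : Finset V, A.card ≤ Z.card ∧ (∀ a ∈ A, a ∈ B) ∧
      ∀ x ∈ B, ∃ a ∈ A, ∀ i, |inner ℝ (x - a) (y i)| ≤ 2 * s := by
  classical
  let P : V → Prop := fun z => ∃ b ∈ B, ∀ i, |inner ℝ (b - z) (y i)| ≤ s
  let f : V → V := fun z => if h : P z then h.choose else 0
  have hf : ∀ z, P z → f z ∈ B ∧ ∀ i, |inner ℝ (f z - z) (y i)| ≤ s := by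
    intro z hz
    simp only [f, dif_pos hz]
    exact hz.choose_spec
  refine ⟨(Z.filter P).image f, Finset.card_image_le.trans (Finset.card_filter_le _ _), ?_, ?_⟩
  · intro a ha
    obtain ⟨z, hz, rfl⟩ := Finset.mem_image.1 ha
    exact (hf z (Finset.mem_filter.1 hz).2).1
  · intro x hx
    obtain ⟨z, hz, hxz⟩ := hcov x hx
    have hPz : P z := ⟨x, hx, hxz⟩
    refine ⟨f z, Finset.mem_image_of_mem _ (Finset.mem_filter.2 ⟨hz, hPz⟩), fun i => ?_⟩
    have e : x - f z = (x - z) - (f z - z) := by abel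
    rw [e, inner_sub_left]
    have h1 := abs_le.1 (hxz i)
    have h2 := abs_le.1 ((hf z hPz).2 i)
    rw [abs_le]
    constructor <;> linarith

theorem rpow_sub_rpow_le {p u v : ℝ} (hp : 1 ≤ p) (hv : 0 ≤ v) (huv : v ≤ u) :
    u ^ p - v ^ p ≤ p * u ^ (p - 1) * (u - v) := by
  rcases (hv.trans huv).eq_or_lt with h0 | hu
  · have : v = 0 := le_antisymm (h0 ▸ huv) hv
    simp [← h0, this]
  · have h := one_add_mul_self_le_rpow_one_add (s := v / u - 1) (by
      have : 0 ≤ v / u := by positivity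
      linarith) hp
    rw [add_sub_cancel, Real.div_rpow hv hu.le, le_div_iff₀ (Real.rpow_pos_of_pos hu p)] at h
    have e : u ^ p = u ^ (p - 1) * u := by
      rw [← Real.rpow_add_one hu.ne']; congr 1; ring
    have e2 : (1 + p * (v / u - 1)) * u ^ p = u ^ p - p * u ^ (p - 1) * (u - v) := by
      rw [e]; field_simp; ring
    linarith

theorem abs_rpow_sub_rpow_le {p : ℝ} (hp : 1 ≤ p) (a b : ℝ) :
    |(|a| ^ p - |b| ^ p)| ≤ p * (|a| ^ (p - 1) + |b| ^ (p - 1)) * |a - b| := by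
  have hp0 : 0 ≤ p := by linarith
  have key : ∀ u v : ℝ, |v| ≤ |u| →
      |(|u| ^ p - |v| ^ p)| ≤ p * (|u| ^ (p - 1) + |v| ^ (p - 1)) * |u - v| := by
    intro u v h
    have h1 := Real.rpow_le_rpow (abs_nonneg v) h hp0
    rw [abs_of_nonneg (by linarith)]
    refine (rpow_sub_rpow_le hp (abs_nonneg v) h).trans ?_
    have h2 : |u| - |v| ≤ |u - v| := abs_sub_abs_le_abs_sub u v
    have h3 : 0 ≤ |v| ^ (p - 1) := by positivity
    have h4 : 0 ≤ |u| ^ (p - 1) := by positivity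
    calc p * |u| ^ (p - 1) * (|u| - |v|) ≤ p * |u| ^ (p - 1) * |u - v| := by gcongr
      _ ≤ _ := by gcongr; linarith
  rcases le_total |b| |a| with h | h
  · exact key a b h
  · have := key b a h
    rwa [abs_sub_comm, abs_sub_comm b a, add_comm] at this

theorem sum_sq_increment_le {N : ℕ} {p R s c : ℝ} (hp : 2 < p) (m a b : Fin N → ℝ)
    (hm0 : ∀ i, 0 ≤ m i) (hm : ∀ i, m i ≤ c) (hc : 0 ≤ c)
    (ha : ∀ i, |a i| ≤ R) (hb : ∀ i, |b i| ≤ R) (hR : 0 ≤ R)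
    (hab : ∀ i, |a i - b i| ≤ s)
    (hsa : ∑ i, m i * |a i| ^ p ≤ 1) (hsb : ∑ i, m i * |b i| ^ p ≤ 1) :
    ∑ i, (m i * |a i| ^ p - m i * |b i| ^ p) ^ 2 ≤ 4 * c * p ^ 2 * s ^ 2 * R ^ (p - 2) := by
  have sq_le : ∀ t : ℝ, |t| ≤ R → (|t| ^ (p - 1)) ^ 2 ≤ R ^ (p - 2) * |t| ^ p := by
    intro t ht
    have : (|t| ^ (p - 1)) ^ 2 = |t| ^ (p - 2) * |t| ^ p := by
      rw [← Real.rpow_natCast, ← Real.rpow_mul (abs_nonneg t),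
        ← Real.rpow_add_of_nonneg (abs_nonneg t) (by linarith) (by linarith)]
      congr 1
      push_cast
      ring
    rw [this]
    gcongr
  have hRp : 0 ≤ R ^ (p - 2) := by positivity
  have term : ∀ i, (m i * |a i| ^ p - m i * |b i| ^ p) ^ 2 ≤
      2 * c * p ^ 2 * s ^ 2 * R ^ (p - 2) * (m i * |a i| ^ p + m i * |b i| ^ p) := by
    intro i
    have hs : 0 ≤ s := (abs_nonneg _).trans (hab i)
    have h1 := abs_rpow_sub_rpow_le (p := p) (by linarith) (a i) (b i)
    have h1' : |(|a i| ^ p - |b i| ^ p)| ≤ p * (|a i| ^ (p - 1) + |b i| ^ (p - 1)) * s :=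
      h1.trans (by gcongr; exact hab i)
    have h2 : (|a i| ^ p - |b i| ^ p) ^ 2 ≤
        (p * (|a i| ^ (p - 1) + |b i| ^ (p - 1)) * s) ^ 2 := by
      rw [← sq_abs]; gcongr
    have h3 : (|a i| ^ (p - 1) + |b i| ^ (p - 1)) ^ 2 ≤
        2 * (R ^ (p - 2) * |a i| ^ p + R ^ (p - 2) * |b i| ^ p) := by
      have := sq_le _ (ha i)
      have := sq_le _ (hb i)
      nlinarith [sq_nonneg (|a i| ^ (p - 1) - |b i| ^ (p - 1))]
    have h4 : m i ^ 2 ≤ c * m i := by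
      have := hm0 i; have := hm i; nlinarith
    calc (m i * |a i| ^ p - m i * |b i| ^ p) ^ 2 = m i ^ 2 * (|a i| ^ p - |b i| ^ p) ^ 2 := by ring
      _ ≤ (c * m i) * (p * (|a i| ^ (p - 1) + |b i| ^ (p - 1)) * s) ^ 2 :=
          mul_le_mul h4 h2 (sq_nonneg _) (mul_nonneg hc (hm0 i))
      _ = (c * m i * p ^ 2 * s ^ 2) * (|a i| ^ (p - 1) + |b i| ^ (p - 1)) ^ 2 := by ring
      _ ≤ (c * m i * p ^ 2 * s ^ 2) *
          (2 * (R ^ (p - 2) * |a i| ^ p + R ^ (p - 2) * |b i| ^ p)) := by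
          have := hm0 i
          gcongr
      _ = _ := by ring
  calc _ ≤ ∑ i, 2 * c * p ^ 2 * s ^ 2 * R ^ (p - 2) * (m i * |a i| ^ p + m i * |b i| ^ p) :=
        Finset.sum_le_sum fun i _ => term i
    _ = 2 * c * p ^ 2 * s ^ 2 * R ^ (p - 2) *
        (∑ i, m i * |a i| ^ p + ∑ i, m i * |b i| ^ p) := by
        rw [← Finset.mul_sum, Finset.sum_add_distrib]
    _ ≤ 2 * c * p ^ 2 * s ^ 2 * R ^ (p - 2) * (1 + 1) := by gcongr
    _ = _ := by ring

theorem abs_sum_increment_le {N : ℕ} {p s : ℝ} (hp : 2 < p) (ε m a b : Fin N → ℝ)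
    (hε : ∀ i, |ε i| ≤ 1) (hm0 : ∀ i, 0 ≤ m i) (hm : ∑ i, m i ≤ 1) (hs : 0 ≤ s)
    (hab : ∀ i, |a i - b i| ≤ s)
    (hsa : ∑ i, m i * |a i| ^ p ≤ 1) (hsb : ∑ i, m i * |b i| ^ p ≤ 1) :
    |∑ i, ε i * (m i * |a i| ^ p) - ∑ i, ε i * (m i * |b i| ^ p)| ≤ 4 * p * s := by
  have pow_le : ∀ t : ℝ, |t| ^ (p - 1) ≤ 1 + |t| ^ p := by
    intro t
    have h0 : 0 ≤ |t| ^ p := by positivity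
    rcases le_total |t| 1 with h | h
    · have := Real.rpow_le_one (abs_nonneg t) h (by linarith : 0 ≤ p - 1)
      linarith
    · have := Real.rpow_le_rpow_of_exponent_le h (by linarith : p - 1 ≤ p)
      linarith
  rw [← Finset.sum_sub_distrib]
  have term : ∀ i, |ε i * (m i * |a i| ^ p) - ε i * (m i * |b i| ^ p)| ≤
      p * s * (2 * m i + m i * |a i| ^ p + m i * |b i| ^ p) := by
    intro i
    have hmi := hm0 i
    have e : ε i * (m i * |a i| ^ p) - ε i * (m i * |b i| ^ p) =
        ε i * (m i * (|a i| ^ p - |b i| ^ p)) := by ring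
    rw [e, abs_mul, abs_mul, abs_of_nonneg hmi]
    have h1 := abs_rpow_sub_rpow_le (p := p) (by linarith) (a i) (b i)
    have h2 := pow_le (a i)
    have h3 := pow_le (b i)
    have h4 := hab i
    have h5 := hε i
    calc _ ≤ 1 * (m i * (p * (|a i| ^ (p - 1) + |b i| ^ (p - 1)) * |a i - b i|)) := by gcongr
      _ ≤ 1 * (m i * (p * ((1 + |a i| ^ p) + (1 + |b i| ^ p)) * s)) := by gcongr
      _ = _ := by ring
  calc _ ≤ ∑ i, |ε i * (m i * |a i| ^ p) - ε i * (m i * |b i| ^ p)| :=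
        Finset.abs_sum_le_sum_abs _ _
    _ ≤ ∑ i, p * s * (2 * m i + m i * |a i| ^ p + m i * |b i| ^ p) :=
        Finset.sum_le_sum fun i _ => term i
    _ = p * s * (2 * ∑ i, m i + ∑ i, m i * |a i| ^ p + ∑ i, m i * |b i| ^ p) := by
        rw [← Finset.mul_sum, Finset.sum_add_distrib, Finset.sum_add_distrib, ← Finset.mul_sum]
    _ ≤ p * s * (2 * 1 + 1 + 1) := by gcongr
    _ = _ := by ring

theorem exists_chaining_nets {E : Type*} [NormedAddCommGroup E] [InnerProductSpace ℝ E]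
    [FiniteDimensional ℝ E] {r n N K : ℕ}
    (hfin : Module.finrank ℝ E = r) (hr : r ≤ n) (hn : 2 ≤ n) (hnN : n ≤ N)
    (hK1 : n ≤ 4 ^ K) (y : Fin N → E) (hy : ∀ i, ‖y i‖ ≤ √n)
    (B : Set (E)) (hB0 : 0 ∈ B) (hB1 : ∀ x ∈ B, ‖x‖ ≤ 1) :
    ∃ A : ℕ → Finset (E), A 0 = {0} ∧ (∀ k, ∀ a ∈ A k, a ∈ B) ∧
      (∀ k ≤ K + 1, ((A k).card : ℝ) ≤ Real.exp (3 * 4 ^ k * Real.log N)) ∧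
      (∀ k ≤ K, ∀ x ∈ B, ∃ a ∈ A k, ∀ i, |inner ℝ (x - a) (y i)| ≤ 2 * (√n / 2 ^ k)) ∧
      ∀ x ∈ B, ∃ a ∈ A (K + 1), ∀ i, |inner ℝ (x - a) (y i)| ≤ 2 / N := by
  have hN : 2 ≤ N := hn.trans hnN
  have hN0 : (0 : ℝ) < N := by exact_mod_cast (by omega : 0 < N)
  have hn0 : (0 : ℝ) < n := by exact_mod_cast (by omega : 0 < n)
  have hsn : 0 < √(n : ℝ) := Real.sqrt_pos.2 hn0
  have hlog : 0 ≤ Real.log N := Real.log_nonneg (by exact_mod_cast (by omega : 1 ≤ N))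
  have hexp : ∀ j : ℕ, ((N ^ j : ℕ) : ℝ) = Real.exp (j * Real.log N) := by
    intro j
    rw [Real.exp_nat_mul, Real.exp_log hN0]
    push_cast
    rfl
  have hgreedy : ∀ k : ℕ, ∃ A : Finset (E),
      (A.card : ℝ) ≤ Real.exp (3 * 4 ^ k * Real.log N) ∧ (∀ a ∈ A, a ∈ B) ∧
      ∀ x ∈ B, ∃ a ∈ A, ∀ i, |inner ℝ (x - a) (y i)| ≤ 2 * (√n / 2 ^ k) := by
    intro k
    obtain ⟨Z, hZ, -, hcov⟩ := exists_greedy_net (fun i => (√(n : ℝ))⁻¹ • y i) (fun i => by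
      rw [norm_smul, norm_inv, Real.norm_of_nonneg hsn.le, inv_mul_le_iff₀ hsn, mul_one]
      exact hy i) (ε := 1 / 2 ^ k) (by positivity) (4 ^ k)
    obtain ⟨A, hA, hAB, hAcov⟩ := exists_net_subset y B Z (s := √n / 2 ^ k) (by
      intro x hx
      obtain ⟨z, hz, h⟩ := hcov x (by
        have h1 := hB1 x hx
        have e : ((4 ^ k : ℕ) : ℝ) * (1 / 2 ^ k) ^ 2 = 1 := by
          push_cast
          rw [div_pow, one_pow, ← pow_mul, mul_comm k 2, pow_mul]
          norm_num
        rw [e]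
        have := norm_nonneg x
        nlinarith)
      refine ⟨z, hz, fun i => ?_⟩
      have h2 := h i
      rw [inner_smul_right, abs_mul, abs_of_pos (inv_pos.2 hsn), inv_mul_le_iff₀ hsn] at h2
      rwa [mul_one_div] at h2)
    refine ⟨A, ?_, hAB, hAcov⟩
    have h3 : 2 * N + 1 ≤ N ^ 3 := by nlinarith [Nat.mul_le_mul hN hN]
    have h4 : A.card ≤ N ^ (3 * 4 ^ k) := by
      rw [pow_mul]
      exact (hA.trans hZ).trans (Nat.pow_le_pow_left h3 _)
    have h5 : (A.card : ℝ) ≤ ((N ^ (3 * 4 ^ k) : ℕ) : ℝ) := by exact_mod_cast h4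
    rw [hexp] at h5
    push_cast at h5
    exact h5
  have hgrid : ∃ A : Finset (E),
      (A.card : ℝ) ≤ Real.exp (3 * 4 ^ (K + 1) * Real.log N) ∧ (∀ a ∈ A, a ∈ B) ∧
      ∀ x ∈ B, ∃ a ∈ A, ∀ i, |inner ℝ (x - a) (y i)| ≤ 2 / N := by
    obtain ⟨Z, hZ, hcov⟩ := exists_grid_net_of_finrank hfin (N ^ 2) (by positivity)
    obtain ⟨A, hA, hAB, hAcov⟩ := exists_net_subset y B Z (s := 1 / N) (by
      intro x hx
      obtain ⟨z, hz, h⟩ := hcov x (hB1 x hx)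
      refine ⟨z, hz, fun i => ?_⟩
      have h1 : √(r : ℝ) ≤ √n := Real.sqrt_le_sqrt (by exact_mod_cast hr)
      have h2 : (n : ℝ) ≤ N := by exact_mod_cast hnN
      have h3 : √(n : ℝ) * √n = n := Real.mul_self_sqrt hn0.le
      calc |inner ℝ (x - z) (y i)| ≤ ‖x - z‖ * ‖y i‖ := abs_real_inner_le_norm _ _
        _ ≤ (√r / (N ^ 2 : ℕ)) * √n := by gcongr; exact hy i
        _ ≤ (√n / (N ^ 2 : ℕ)) * √n := by gcongr
        _ = n / (N ^ 2 : ℕ) := by rw [div_mul_eq_mul_div, h3]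
        _ ≤ N / (N ^ 2 : ℕ) := by gcongr
        _ = 1 / N := by push_cast; field_simp)
    refine ⟨A, ?_, hAB, by simpa only [mul_one_div] using hAcov⟩
    have h3 : 2 * N ^ 2 + 1 ≤ N ^ 4 := by
      have : 4 ≤ N ^ 2 := by nlinarith
      have e : N ^ 4 = N ^ 2 * N ^ 2 := by ring
      nlinarith
    have h4 : A.card ≤ N ^ (3 * 4 ^ (K + 1)) := by
      calc A.card ≤ (2 * N ^ 2 + 1) ^ r := hA.trans hZ
        _ ≤ (N ^ 4) ^ r := Nat.pow_le_pow_left h3 _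
        _ = N ^ (4 * r) := by rw [pow_mul]
        _ ≤ _ := Nat.pow_le_pow_right (by omega) (by rw [pow_succ]; omega)
    have h5 : (A.card : ℝ) ≤ ((N ^ (3 * 4 ^ (K + 1)) : ℕ) : ℝ) := by exact_mod_cast h4
    rw [hexp] at h5
    push_cast at h5
    exact h5
  choose A₁ hA₁ hA₁B hA₁c using hgreedy
  obtain ⟨A₂, hA₂, hA₂B, hA₂c⟩ := hgrid
  refine ⟨fun k => if k = 0 then {0} else if k ≤ K then A₁ k else A₂, by simp, ?_, ?_, ?_, ?_⟩
  · intro k a ha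
    by_cases h0 : k = 0
    · simp only [h0, if_true, Finset.mem_singleton] at ha
      exact ha ▸ hB0
    · by_cases hk : k ≤ K
      · simp only [h0, hk, if_true, if_false] at ha
        exact hA₁B k a ha
      · simp only [h0, hk, if_false] at ha
        exact hA₂B a ha
  · intro k hkK
    by_cases h0 : k = 0
    · simp only [h0, if_true, Finset.card_singleton, Nat.cast_one]
      exact Real.one_le_exp (by positivity)
    · by_cases hk : k ≤ K
      · simp only [h0, hk, if_true, if_false]
        exact hA₁ k
      · simp only [h0, hk, if_false]
        obtain rfl : k = K + 1 := by omega
        exact hA₂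
  · intro k hk x hx
    by_cases h0 : k = 0
    · subst h0
      refine ⟨0, by simp, fun i => ?_⟩
      have h1 := abs_real_inner_le_norm x (y i)
      have h2 := hB1 x hx
      have h3 := hy i
      have := norm_nonneg x
      have := norm_nonneg (y i)
      rw [sub_zero, pow_zero, div_one]
      nlinarith
    · simp only [h0, hk, if_true, if_false]
      exact hA₁c k x hx
  · simpa using hA₂c

theorem exists_signs_chaining {E : Type*} [NormedAddCommGroup E] [InnerProductSpace ℝ E]
    [FiniteDimensional ℝ E] {r n N : ℕ}
    (hfin : Module.finrank ℝ E = r) {p : ℝ} (hp : 2 < p) (hr : r ≤ n) (hn : 2 ≤ n)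
    (hnN : n ≤ N) (hN : 32 ≤ N) (m : Fin N → ℝ) (hm0 : ∀ i, 0 ≤ m i) (hm4 : ∀ i, m i ≤ 4 / N)
    (hm1 : ∑ i, m i ≤ 1) (y : Fin N → E) (hy : ∀ i, ‖y i‖ ≤ √n)
    (B : Set (E)) (hB0 : 0 ∈ B) (hB1 : ∀ x ∈ B, ‖x‖ ≤ 1)
    (hBp : ∀ x ∈ B, ∑ i, m i * |inner ℝ x (y i)| ^ p ≤ 1) (J : Finset (Fin N)) :
    ∃ ε : Fin N → ℝ, (∀ i, ε i = 1 ∨ ε i = -1) ∧ |∑ i ∈ J, ε i| ≤ N / 2 ∧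
      ∀ x ∈ B, |∑ i, ε i * (m i * |inner ℝ x (y i)| ^ p)| ≤
        300 * p * √((n : ℝ) ^ (p / 2) / N) * Real.log n * √(Real.log N) := by
  classical
  have hN32 : (32 : ℝ) ≤ N := by exact_mod_cast hN
  have hN0 : (0 : ℝ) < N := by linarith
  have hn2 : (2 : ℝ) ≤ n := by exact_mod_cast hn
  have hn0 : (0 : ℝ) < n := by linarith
  have hnN' : (n : ℝ) ≤ N := by exact_mod_cast hnN
  have hlog1 : 1 ≤ Real.log N := by
    rw [Real.le_log_iff_exp_le hN0]
    exact (Real.exp_one_lt_three.le).trans (by linarith)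
  set ℓ := Real.log N with hℓ
  set R := √(n : ℝ) with hRdef
  have hR0 : 0 ≤ R := Real.sqrt_nonneg _
  have hRsq : R ^ 2 = n := Real.sq_sqrt hn0.le
  obtain ⟨K, hK1, hK2⟩ : ∃ K : ℕ, n ≤ 4 ^ K ∧ 4 ^ K ≤ 4 * n := by
    refine ⟨Nat.clog 4 n, Nat.le_pow_clog (by norm_num) n, ?_⟩
    have h1 := Nat.pow_pred_clog_lt_self (b := 4) (by norm_num) (x := n) (by omega)
    have h2 : 0 < Nat.clog 4 n := Nat.clog_pos (by norm_num) hn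
    obtain ⟨j, hj⟩ : ∃ j, Nat.clog 4 n = j + 1 := ⟨_, (Nat.succ_pred_eq_of_pos h2).symm⟩
    rw [hj] at h1 ⊢
    rw [pow_succ]
    simp only [Nat.pred_succ] at h1
    omega
  obtain ⟨A, hA0, hAB, hAcard, hAcov, hAlast⟩ :=
    exists_chaining_nets hfin hr hn hnN hK1 y hy B hB0 hB1
  have hlast : 2 / (N : ℝ) ≤ R / 2 ^ K := by
    have h1 : ((2 : ℝ) ^ K) ^ 2 ≤ (2 * R) ^ 2 := by
      rw [mul_pow, hRsq, ← pow_mul, mul_comm K 2, pow_mul]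
      norm_num
      exact_mod_cast hK2
    have h2 : (2 : ℝ) ^ K ≤ 2 * R := (pow_le_pow_iff_left₀ (by positivity) (by positivity)
      two_ne_zero).1 h1
    have h3 : (2 : ℝ) / N ≤ 1 / 2 := by
      rw [div_le_div_iff₀ hN0 (by norm_num)]; linarith
    refine h3.trans ?_
    rw [div_le_div_iff₀ (by norm_num) (by positivity)]
    linarith
  let f : E → Fin N → ℝ := fun x i => m i * |inner ℝ x (y i)| ^ p
  let P : ℕ → E × E → Prop := fun k c =>
    ∀ i, |inner ℝ c.1 (y i) - inner ℝ c.2 (y i)| ≤ 3 * (R / 2 ^ k)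
  let U : ℕ → Finset (Fin N → ℝ) := fun k => k.casesOn {fun i => if i ∈ J then 1 else 0}
    fun k => ((A (k + 1) ×ˢ A k).filter (P k)).image fun c => f c.1 - f c.2
  let σ : ℕ → ℝ := fun k => k.casesOn (√N)
    fun k => 4 * p * (3 * (R / 2 ^ k)) * √(R ^ (p - 2) / N)
  let L : ℕ → ℝ := fun k => k.casesOn (N / 8 : ℝ) fun k => 17 * 4 ^ k * ℓ
  have hU0 : U 0 = {fun i => if i ∈ J then 1 else 0} := rfl
  have hσ0 : σ 0 = √N := rfl
  have hL0 : L 0 = (N / 8 : ℝ) := rfl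
  have hp0 : 0 ≤ p := by linarith
  obtain ⟨ε, hε, hεU⟩ := exists_signs_forall_abs_le (M := K + 2) U σ L
    (by
      rintro (_ | k)
      · rw [hσ0]; positivity
      · simp only [σ]; positivity)
    (by
      rintro (_ | k)
      · rw [hL0]; positivity
      · simp only [L]; positivity)
    (by
      rintro (_ | k) hk v hv
      · rw [hU0, Finset.mem_singleton] at hv
        rw [hσ0, hv, Real.sq_sqrt hN0.le]
        calc _ ≤ ∑ _i : Fin N, (1 : ℝ) :=
              Finset.sum_le_sum fun i _ => by dsimp only; split_ifs <;> norm_num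
          _ = N := by simp
      · simp only [U, Finset.mem_image, Finset.mem_filter, Finset.mem_product] at hv
        obtain ⟨⟨a, b⟩, ⟨⟨ha, hb⟩, hab⟩, rfl⟩ := hv
        have hin : ∀ x ∈ B, ∀ i, |inner ℝ x (y i)| ≤ R := by
          intro x hx i
          refine (abs_real_inner_le_norm _ _).trans ?_
          have h1 := hB1 x hx
          have h2 := hy i
          have := norm_nonneg (y i)
          have := norm_nonneg x
          nlinarith
        have := sum_sq_increment_le (c := 4 / N) hp m (fun i => inner ℝ a (y i))
          (fun i => inner ℝ b (y i)) hm0 hm4 (by positivity) (hin a (hAB _ a ha))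
          (hin b (hAB _ b hb)) hR0 hab (hBp a (hAB _ a ha)) (hBp b (hAB _ b hb))
        refine this.trans (le_of_eq ?_)
        simp only [σ]
        rw [mul_pow _ (√(R ^ (p - 2) / N)), Real.sq_sqrt (by positivity)]
        ring)
    (by
      rw [Finset.sum_range_succ']
      have h0 : ((U 0).card : ℝ) * (2 * Real.exp (-L 0)) ≤ 2 / 5 := by
        rw [hU0, hL0, Finset.card_singleton, Nat.cast_one, one_mul]
        have h1 : 5 ≤ Real.exp (N / 8) := by
          have := Real.add_one_le_exp (N / 8 : ℝ)
          linarith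
        rw [Real.exp_neg]
        have h2 : (Real.exp (N / 8))⁻¹ ≤ 5⁻¹ := inv_anti₀ (by norm_num) h1
        linarith
      have hterm : ∀ k ∈ Finset.range (K + 1),
          ((U (k + 1)).card : ℝ) * (2 * Real.exp (-L (k + 1))) ≤ 2 / (N : ℝ) ^ 2 := by
        intro k hk
        have hk' : k ≤ K := by have := Finset.mem_range.1 hk; omega
        have hc : ((U (k + 1)).card : ℝ) ≤
            Real.exp (3 * 4 ^ (k + 1) * ℓ) * Real.exp (3 * 4 ^ k * ℓ) := by
          have h1 : (U (k + 1)).card ≤ (A (k + 1)).card * (A k).card := by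
            rw [← Finset.card_product]
            exact Finset.card_image_le.trans (Finset.card_filter_le _ _)
          calc ((U (k + 1)).card : ℝ) ≤ (A (k + 1)).card * (A k).card := by exact_mod_cast h1
            _ ≤ _ := by
                gcongr
                · exact hAcard _ (by omega)
                · exact hAcard _ (by omega)
        have h4k : (1 : ℝ) ≤ 4 ^ k := one_le_pow₀ (by norm_num)
        calc _ ≤ Real.exp (3 * 4 ^ (k + 1) * ℓ) * Real.exp (3 * 4 ^ k * ℓ) *
              (2 * Real.exp (-(17 * 4 ^ k * ℓ))) := by gcongr
          _ = 2 * Real.exp (-(2 * 4 ^ k * ℓ)) := by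
              rw [mul_left_comm, ← Real.exp_add, ← Real.exp_add]
              ring_nf
          _ ≤ 2 * Real.exp (-(2 * 1 * ℓ)) := by gcongr
          _ = 2 / (N : ℝ) ^ 2 := by
              rw [mul_one, Real.exp_neg, div_eq_mul_inv, two_mul ℓ, Real.exp_add, hℓ,
                Real.exp_log hN0, sq]
      have hs := Finset.sum_le_sum hterm
      rw [Finset.sum_const, Finset.card_range, nsmul_eq_mul] at hs
      have hK3 : ((K + 1 : ℕ) : ℝ) ≤ 4 * N := by
        have h1 : K < 4 ^ K := Nat.lt_pow_self (by norm_num)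
        have h2 : K + 1 ≤ 4 * N := by omega
        exact_mod_cast h2
      have hs2 : ((K + 1 : ℕ) : ℝ) * (2 / (N : ℝ) ^ 2) ≤ 1 / 4 := by
        calc _ ≤ (4 * N : ℝ) * (2 / (N : ℝ) ^ 2) := by gcongr
          _ = 8 / N := by field_simp; norm_num
          _ ≤ 1 / 4 := by rw [div_le_div_iff₀ hN0 (by norm_num)]; linarith
      linarith)
  refine ⟨ε, hε, ?_, ?_⟩
  · have h := hεU 0 (by omega) _ (Finset.mem_singleton_self _)
    simp only [mul_ite, mul_one, mul_zero, Finset.sum_ite_mem, Finset.univ_inter, hσ0, hL0] at h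
    refine h.trans (le_of_eq ?_)
    rw [← Real.sqrt_mul hN0.le, show (N : ℝ) * (2 * (N / 8)) = (N / 2) ^ 2 by ring,
      Real.sqrt_sq (by positivity)]
  · intro x hx
    set D := p * √((n : ℝ) ^ (p / 2) / N) * √ℓ with hD
    have hlevel : ∀ k, σ (k + 1) * √(2 * L (k + 1)) ≤ 70 * D := by
      intro k
      have e1 : √(2 * (17 * 4 ^ k * ℓ)) = √34 * 2 ^ k * √ℓ := by
        rw [show 2 * (17 * 4 ^ k * ℓ) = 34 * (2 ^ k) ^ 2 * ℓ by
          rw [← pow_mul, mul_comm k 2, pow_mul]; norm_num; ring,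
          Real.sqrt_mul (by positivity), Real.sqrt_mul (by norm_num), Real.sqrt_sq (by positivity)]
      have e2 : R * √(R ^ (p - 2) / N) = √((n : ℝ) ^ (p / 2) / N) := by
        nth_rewrite 1 [← Real.sqrt_sq hR0]
        rw [← Real.sqrt_mul (by positivity), ← mul_div_assoc]
        congr 2
        rw [← Real.rpow_natCast, ← Real.rpow_add_of_nonneg hR0 (by norm_num) (by linarith), hRdef,
          Real.sqrt_eq_rpow, ← Real.rpow_mul hn0.le]
        congr 1
        push_cast
        ring
      have e3 : √(34 : ℝ) ≤ 35 / 6 := by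
        rw [Real.sqrt_le_left (by norm_num)]; norm_num
      simp only [σ, L]
      rw [e1]
      calc _ = 12 * √34 * (p * (R * √(R ^ (p - 2) / N)) * √ℓ) := by field_simp; ring
        _ = 12 * √34 * D := by rw [e2]
        _ ≤ 12 * (35 / 6) * D := by gcongr
        _ = 70 * D := by ring
    have hcov : ∀ k, k ≤ K + 1 → ∃ a ∈ A k,
        ∀ i, |inner ℝ (x - a) (y i)| ≤ if k ≤ K then 2 * (R / 2 ^ k) else 2 / N := by
      intro k hk
      by_cases h : k ≤ K
      · simp only [h, if_true]; exact hAcov k h x hx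
      · simp only [h, if_false]
        obtain rfl : k = K + 1 := by omega
        exact hAlast x hx
    choose! z hzA hz using hcov
    let F : E → ℝ := fun x => ∑ i, ε i * f x i
    have hstep : ∀ k ∈ Finset.range (K + 1), |F (z (k + 1)) - F (z k)| ≤ 70 * D := by
      intro k hk
      have hk' : k ≤ K := by have := Finset.mem_range.1 hk; omega
      have hP : P k (z (k + 1), z k) := by
        intro i
        have h1 := hz k (by omega) i
        have h2 := hz (k + 1) (by omega) i
        rw [if_pos hk'] at h1
        have h2' : |inner ℝ (x - z (k + 1)) (y i)| ≤ R / 2 ^ k := by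
          split_ifs at h2 with h3
          · refine h2.trans (le_of_eq ?_)
            rw [pow_succ]; field_simp
          · obtain rfl : k = K := by omega
            exact h2.trans hlast
        have e : inner ℝ (z (k + 1)) (y i) - inner ℝ (z k) (y i) =
            inner ℝ (x - z k) (y i) - inner ℝ (x - z (k + 1)) (y i) := by
          simp only [inner_sub_left]; ring
        simp only [e]
        refine (abs_sub _ _).trans ?_
        linarith
      have := hεU (k + 1) (by omega) (f (z (k + 1)) - f (z k))
        (Finset.mem_image.2 ⟨(z (k + 1), z k), Finset.mem_filter.2
          ⟨Finset.mk_mem_product (hzA _ (by omega)) (hzA _ (by omega)), hP⟩, rfl⟩)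
      have e : F (z (k + 1)) - F (z k) = ∑ i, ε i * (f (z (k + 1)) - f (z k)) i := by
        simp only [F, Pi.sub_apply, mul_sub, Finset.sum_sub_distrib]
      rw [e]
      exact this.trans (hlevel k)
    have hF0 : F (z 0) = 0 := by
      have : z 0 = 0 := by
        have := hzA 0 (by omega)
        rw [hA0] at this
        exact Finset.mem_singleton.1 this
      simp only [F, f, this, inner_zero_left, abs_zero]
      simp [Real.zero_rpow (by linarith : p ≠ 0)]
    have htel : F (z (K + 1)) = ∑ k ∈ Finset.range (K + 1), (F (z (k + 1)) - F (z k)) := by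
      rw [Finset.sum_range_sub (fun k => F (z k)), hF0, sub_zero]
    have h1 : |F (z (K + 1))| ≤ ((K + 1 : ℕ) : ℝ) * (70 * D) := by
      rw [htel]
      refine (Finset.abs_sum_le_sum_abs _ _).trans ((Finset.sum_le_sum hstep).trans (le_of_eq ?_))
      rw [Finset.sum_const, Finset.card_range, nsmul_eq_mul]
    have h2 : |F x - F (z (K + 1))| ≤ 4 * p * (2 / N) := by
      refine abs_sum_increment_le hp ε m (fun i => inner ℝ x (y i))
        (fun i => inner ℝ (z (K + 1)) (y i)) ?_ hm0 hm1 (by positivity) ?_ (hBp x hx)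
        (hBp _ (hAB _ _ (hzA _ le_rfl)))
      · intro i
        rcases hε i with h | h <;> simp [h]
      · intro i
        have := hz (K + 1) le_rfl i
        rw [if_neg (by omega), inner_sub_left] at this
        exact this
    have hlogn : 1 / 2 ≤ Real.log n := by
      have := Real.log_le_log (by norm_num) hn2
      have := Real.log_two_gt_d9
      linarith
    have hKlog : ((K + 1 : ℕ) : ℝ) ≤ 4 * Real.log n := by
      have h3 : ((4 : ℝ) ^ K) ≤ 4 * n := by exact_mod_cast hK2
      have h4 := Real.log_le_log (by positivity) h3
      have e4 : Real.log 4 = 2 * Real.log 2 := by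
        rw [show (4 : ℝ) = 2 ^ 2 by norm_num, Real.log_pow]; norm_num
      rw [Real.log_pow, Real.log_mul (by norm_num) hn0.ne', e4] at h4
      have h5 := Real.log_le_log (by norm_num) hn2
      have h6 := Real.log_two_gt_d9
      push_cast
      have h7 : (K : ℝ) * 1.38 ≤ K * (2 * Real.log 2) := by gcongr; linarith
      have h8 := Real.log_two_lt_d9
      linarith
    have hD0 : 0 ≤ D := by positivity
    have hND : p / N ≤ D := by
      have h3 : 1 / (N : ℝ) ≤ √((n : ℝ) ^ (p / 2) / N) := by
        apply Real.le_sqrt_of_sq_le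
        have h4 : (1 : ℝ) ≤ (n : ℝ) ^ (p / 2) := Real.one_le_rpow (by linarith) (by linarith)
        calc (1 / (N : ℝ)) ^ 2 = 1 / N * (1 / N) := by ring
          _ ≤ 1 * (1 / N) := by
              gcongr
              rw [div_le_one hN0]; linarith
          _ ≤ _ := by rw [one_mul]; gcongr
      have h4 : 1 ≤ √ℓ := Real.one_le_sqrt.2 hlog1
      calc p / N = p * (1 / N) * 1 := by ring
        _ ≤ _ := by rw [hD]; gcongr
    have h3 : |F x| ≤ |F x - F (z (K + 1))| + |F (z (K + 1))| := by
      have := abs_add_le (F x - F (z (K + 1))) (F (z (K + 1)))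
      simpa using this
    calc |F x| ≤ 4 * p * (2 / N) + ((K + 1 : ℕ) : ℝ) * (70 * D) := h3.trans (add_le_add h2 h1)
      _ = 8 * (p / N) + ((K + 1 : ℕ) : ℝ) * (70 * D) := by ring
      _ ≤ 8 * D + 4 * Real.log n * (70 * D) := by gcongr
      _ ≤ 300 * Real.log n * D := by nlinarith
      _ = _ := by rw [hD]; ring

/-- Lewis' theorem for finitely many spanning vectors. -/
theorem exists_lewis_position {E : Type*} [NormedAddCommGroup E] [InnerProductSpace ℝ E]
    [FiniteDimensional ℝ E] {r N : ℕ} (hfin : Module.finrank ℝ E = r) {p : ℝ} (hp : 2 < p)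
    (hr : 0 < r) (z : Fin N → E) (hz : Submodule.span ℝ (Set.range z) = ⊤) :
    ∃ A : E →L[ℝ] E, A.det ≠ 0 ∧
      ∑ i, ‖A (z i)‖ ^ p = 1 ∧
      ∀ x, ‖x‖ ^ 2 = r * ∑ i, ‖A (z i)‖ ^ (p - 2) * inner ℝ x (A (z i)) ^ 2 := by
  have hp0 : 0 < p := by linarith
  have hr0 : (0 : ℝ) < r := by exact_mod_cast hr
  let G : (E →L[ℝ] E) → ℝ := fun A => ∑ i, ‖A (z i)‖ ^ p
  have hG0 : ∀ A, 0 ≤ G A := fun A => Finset.sum_nonneg fun i _ => by positivity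
  let Φ : (E →L[ℝ] E) →ₗ[ℝ] (Fin N → E) :=
    { toFun := fun A i => A (z i)
      map_add' := fun A B => rfl
      map_smul' := fun c A => rfl }
  have hΦ : Φ.ker = ⊥ := by
    rw [LinearMap.ker_eq_bot']
    intro A hA
    have : (A : E →ₗ[ℝ] E) = 0 := LinearMap.ext_on_range hz fun i => congrFun hA i
    ext1 x
    exact congrArg (fun f : E →ₗ[ℝ] E => f x) this
  have hGcont : Continuous fun w : Fin N → E => ∑ i, ‖w i‖ ^ p := by
    refine continuous_finsetSum _ fun i _ => ?_
    exact (continuous_norm.comp (continuous_apply i)).rpow_const fun _ => Or.inr hp0.le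
  have hKc : IsCompact {w : Fin N → E | ∑ i, ‖w i‖ ^ p ≤ 1} := by
    refine Metric.isCompact_of_isClosed_isBounded (isClosed_le hGcont continuous_const) ?_
    refine (Metric.isBounded_closedBall (x := (0 : Fin N → E)) (r := 1)).subset fun w hw => ?_
    rw [mem_closedBall_zero_iff, pi_norm_le_iff_of_nonneg zero_le_one]
    intro i
    have h1 : ‖w i‖ ^ p ≤ 1 := (Finset.single_le_sum (f := fun i => ‖w i‖ ^ p)
      (fun i _ => by positivity) (Finset.mem_univ i)).trans hw
    by_contra! h
    exact absurd h1 (not_le.2 (Real.one_lt_rpow h hp0))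
  have hcomp : IsCompact {A : E →L[ℝ] E | G A ≤ 1} :=
    (LinearMap.isClosedEmbedding_of_injective hΦ).isCompact_preimage hKc
  obtain ⟨A, hA1, hAmax⟩ := hcomp.exists_isMaxOn ⟨0, by simp [G, Real.zero_rpow hp0.ne']⟩
    (f := fun A : E →L[ℝ] E => |A.det|) (ContinuousLinearMap.continuous_det.abs.continuousOn)
  have hdet_smul : ∀ (c : ℝ) (B : E →L[ℝ] E), (c • B).det = c ^ r * B.det := by
    intro c B
    have := LinearMap.det_smul c (B : E →ₗ[ℝ] E)
    rwa [hfin] at this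
  have hG_smul : ∀ (c : ℝ) (B : E →L[ℝ] E), 0 ≤ c → G (c • B) = c ^ p * G B := by
    intro c B hc
    simp only [G, Finset.mul_sum]
    refine Finset.sum_congr rfl fun i _ => ?_
    rw [_root_.smul_apply, norm_smul, Real.norm_of_nonneg hc,
      Real.mul_rpow hc (norm_nonneg _)]
  have hscale : ∀ B : E →L[ℝ] E, 0 < G B → |B.det| ≤ |A.det| * G B ^ ((r : ℝ) / p) := by
    intro B hB
    set c := G B ^ (-(1 / p)) with hc
    have hc0 : 0 < c := Real.rpow_pos_of_pos hB _
    have h1 : G (c • B) ≤ 1 := by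
      rw [hG_smul c B hc0.le, hc, ← Real.rpow_mul hB.le]
      have : -(1 / p) * p = -1 := by field_simp
      rw [this, Real.rpow_neg_one, inv_mul_cancel₀ hB.ne']
    have h2 : |(c • B).det| ≤ |A.det| := hAmax h1
    rw [hdet_smul, abs_mul, abs_of_pos (pow_pos hc0 r)] at h2
    have h3 : c ^ r * G B ^ ((r : ℝ) / p) = 1 := by
      rw [hc, ← Real.rpow_natCast, ← Real.rpow_mul hB.le, ← Real.rpow_add hB]
      have : -(1 / p) * (r : ℝ) + r / p = 0 := by ring
      rw [this, Real.rpow_zero]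
    calc |B.det| = (c ^ r * |B.det|) * G B ^ ((r : ℝ) / p) := by
          rw [mul_right_comm, h3, one_mul]
      _ ≤ _ := by gcongr
  have hAdet : 0 < |A.det| := by
    have hid : G (ContinuousLinearMap.id ℝ E) > 0 := by
      refine lt_of_le_of_ne (hG0 _) fun h0 => ?_
      have h1 := (Finset.sum_eq_zero_iff_of_nonneg fun i _ => by positivity).1 h0.symm
      have h2 : Set.range z ⊆ {0} := by
        rintro _ ⟨i, rfl⟩
        have h3 := h1 i (Finset.mem_univ i)
        rw [Real.rpow_eq_zero (norm_nonneg _) hp0.ne'] at h3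
        simpa using h3
      have h4 : (⊤ : Submodule ℝ E) = ⊥ := by
        rw [← hz, Submodule.span_eq_bot]
        intro x hx
        exact h2 hx
      have h5 : Module.finrank ℝ (⊤ : Submodule ℝ E) = 0 := by rw [h4]; simp
      rw [finrank_top, hfin] at h5
      omega
    have h := hscale _ hid
    have hd : (ContinuousLinearMap.id ℝ E).det = 1 := LinearMap.det_id
    rw [hd, abs_one] at h
    by_contra! hneg
    have : |A.det| = 0 := le_antisymm hneg (abs_nonneg _)
    rw [this, zero_mul] at h
    linarith
  have hApos : 0 < G A := by
    refine lt_of_le_of_ne (hG0 _) fun h0 => ?_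
    have h1 := (Finset.sum_eq_zero_iff_of_nonneg fun i _ => by positivity).1 h0.symm
    have h2 : A = 0 := by
      refine (LinearMap.ker_eq_bot'.1 hΦ) A (funext fun i => ?_)
      have h3 := h1 i (Finset.mem_univ i)
      rw [Real.rpow_eq_zero (norm_nonneg _) hp0.ne'] at h3
      simpa [Φ] using h3
    have h4 := hdet_smul 0 A
    rw [zero_smul, ← h2, zero_pow hr.ne', zero_mul] at h4
    rw [h4, abs_zero] at hAdet
    exact lt_irrefl _ hAdet
  have hGA : G A = 1 := by
    refine le_antisymm hA1 ?_
    have h := hscale A hApos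
    by_contra! hlt
    have h2 : G A ^ ((r : ℝ) / p) < 1 := Real.rpow_lt_one hApos.le hlt (by positivity)
    nlinarith
  refine ⟨A, abs_pos.1 hAdet, hGA, fun x => ?_⟩
  let S : ℝ → E →L[ℝ] E := fun t =>
    LinearMap.toContinuousLinearMap (LinearMap.transvection (t • (innerSL ℝ x : E →ₗ[ℝ] ℝ)) x)
  have hS : ∀ t w, S t w = w + (t * inner ℝ x w) • x := by
    intro t w
    simp [S, LinearMap.transvection.apply]
  have hSdet : ∀ t, (S t ∘L A).det = (1 + t * ‖x‖ ^ 2) * A.det := by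
    intro t
    have h1 := LinearMap.transvection.det (t • (innerSL ℝ x : E →ₗ[ℝ] ℝ)) x
    have h2 : (S t ∘L A).det = LinearMap.det
      (LinearMap.transvection (t • (innerSL ℝ x : E →ₗ[ℝ] ℝ)) x ∘ₗ (A : E →ₗ[ℝ] E)) := rfl
    rw [h2, LinearMap.det_comp, h1]
    simp [ContinuousLinearMap.det]
  let g : ℝ → ℝ := fun t => G (S t ∘L A)
  have hg0 : g 0 = 1 := by
    rw [← hGA]
    simp [g, G, hS]
  have hgd : HasDerivAt g
      (∑ i, p * ‖A (z i)‖ ^ (p - 2) * inner ℝ x (A (z i)) ^ 2) 0 := by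
    have e : g = fun t => ∑ i, ‖A (z i) + (t * inner ℝ x (A (z i))) • x‖ ^ p := by
      funext t
      simp [g, G, hS]
    rw [e]
    refine HasDerivAt.fun_sum fun i _ => ?_
    have h1 : HasDerivAt (fun t : ℝ => A (z i) + (t * inner ℝ x (A (z i))) • x)
        ((1 * inner ℝ x (A (z i))) • x) 0 :=
      (((hasDerivAt_id (0 : ℝ)).mul_const _).smul_const x).const_add _
    have h2 := hasFDerivAt_norm_rpow (A (z i)) (p := p) (by linarith)
    have h3 := HasFDerivAt.comp_hasDerivAt_of_eq (0 : ℝ) h2 h1 (by simp)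
    refine h3.congr_deriv ?_
    simp only [one_mul, _root_.smul_apply, innerSL_apply_apply, smul_eq_mul,
      inner_smul_right, real_inner_comm x (A (z i))]
    ring
  have hfd : HasDerivAt (fun t => g t ^ ((r : ℝ) / p) - (1 + t * ‖x‖ ^ 2))
      ((∑ i, p * ‖A (z i)‖ ^ (p - 2) * inner ℝ x (A (z i)) ^ 2) * (r / p) *
        g 0 ^ ((r : ℝ) / p - 1) - 1 * ‖x‖ ^ 2) 0 :=
    (hgd.rpow_const (Or.inl (by rw [hg0]; norm_num))).sub
      (((hasDerivAt_id (0 : ℝ)).mul_const _).const_add _)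
  have hmin : IsLocalMin (fun t => g t ^ ((r : ℝ) / p) - (1 + t * ‖x‖ ^ 2)) 0 := by
    have hpos : ∀ᶠ t in nhds (0 : ℝ), 0 < g t :=
      hgd.continuousAt.eventually_const_lt (by rw [hg0]; norm_num)
    filter_upwards [hpos] with t ht
    have h := hscale _ ht
    rw [hSdet, abs_mul, mul_comm] at h
    have h1 := le_of_mul_le_mul_left h hAdet
    have h2 := le_abs_self (1 + t * ‖x‖ ^ 2)
    rw [hg0, Real.one_rpow]
    simp only [zero_mul]
    change |1 + t * ‖x‖ ^ 2| ≤ g t ^ _ at h1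
    linarith
  have hzero := hmin.hasDerivAt_eq_zero hfd
  rw [hg0, Real.one_rpow, mul_one, one_mul, sub_eq_zero] at hzero
  rw [← hzero, Finset.mul_sum, Finset.sum_mul]
  refine Finset.sum_congr rfl fun i _ => ?_
  field_simp

/-- Balanced signs for a system of vectors in Lewis position, written as weights
`θ i ∈ {0, 1/2, 1}` few of which are nonzero and few of which differ from one. -/
lemma exists_weights_of_lewis_position {E : Type*} [NormedAddCommGroup E]
    [InnerProductSpace ℝ E] [FiniteDimensional ℝ E] {r n N : ℕ}
    (hfin : Module.finrank ℝ E = r) {p : ℝ} (hp : 2 < p) (hrn : r ≤ n)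
    (hn : 2 ≤ n) (hnN : n ≤ N) (hN : 32 ≤ N) (w : Fin N → E)
    (hw1 : ∑ i, ‖w i‖ ^ p = 1)
    (hw2 : ∀ x, ‖x‖ ^ 2 = r * ∑ i, ‖w i‖ ^ (p - 2) * inner ℝ x (w i) ^ 2) :
    ∃ θ : Fin N → ℝ, (∀ i, 0 ≤ θ i ∧ θ i ≤ 1) ∧
      8 * ((Finset.univ.filter fun i => θ i ≠ 0).card : ℝ) ≤ 7 * N ∧
      8 * ((Finset.univ.filter fun i => θ i ≠ 1).card : ℝ) ≤ 7 * N ∧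
      ∀ x, |∑ i, (2 * θ i - 1) * |inner ℝ x (w i)| ^ p| ≤
        300 * p * √((n : ℝ) ^ (p / 2) / N) * Real.log n * √(Real.log N) *
          ∑ i, |inner ℝ x (w i)| ^ p := by
  have hp0 : p ≠ 0 := by linarith
  have hNpos : (0 : ℝ) < N := by exact_mod_cast (by omega : 0 < N)
  rcases Nat.eq_zero_or_pos r with hr0 | hr
  · have : ∀ i, w i = 0 := fun i => by
      have h := hw2 (w i)
      rw [hr0, Nat.cast_zero, zero_mul] at h
      exact norm_eq_zero.1 (pow_eq_zero_iff two_ne_zero |>.1 h)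
    simp [this, Real.zero_rpow hp0] at hw1
  have hrpos : (0 : ℝ) < r := by exact_mod_cast hr
  set m : Fin N → ℝ := fun i => ‖w i‖ ^ p with hm
  set y : Fin N → E := fun i => √r • (‖w i‖⁻¹ • w i) with hy
  have hm0 : ∀ i, 0 ≤ m i := fun i => by positivity
  have hinner : ∀ x i, inner ℝ x (y i) = √r * (‖w i‖⁻¹ * inner ℝ x (w i)) := fun x i => by
    simp [hy, inner_smul_right]
  have hmy : ∀ x i, m i * |inner ℝ x (y i)| ^ p = (r : ℝ) ^ (p / 2) * |inner ℝ x (w i)| ^ p := by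
    intro x i
    by_cases h0 : w i = 0
    · simp [hm, h0, Real.zero_rpow hp0]
    have hpos : 0 < ‖w i‖ := norm_pos_iff.2 h0
    rw [hinner, abs_mul, abs_mul, abs_of_nonneg (Real.sqrt_nonneg _),
      abs_of_pos (inv_pos.2 hpos), Real.mul_rpow (by positivity) (by positivity),
      Real.mul_rpow (by positivity) (by positivity), Real.inv_rpow hpos.le,
      Real.sqrt_eq_rpow, ← Real.rpow_mul hrpos.le]
    have : ‖w i‖ ^ p ≠ 0 := by positivity
    simp only [hm]
    rw [show (1 / 2 : ℝ) * p = p / 2 by ring]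
    field_simp
  have hnorm : ∀ x, ‖x‖ ^ 2 = ∑ i, m i * inner ℝ x (y i) ^ 2 := by
    intro x
    rw [hw2, Finset.mul_sum]
    refine Finset.sum_congr rfl fun i _ => ?_
    by_cases h0 : w i = 0
    · simp [h0, hinner]
    have hpos : 0 < ‖w i‖ := norm_pos_iff.2 h0
    rw [hinner, mul_pow, mul_pow, Real.sq_sqrt hrpos.le]
    simp only [hm]
    rw [Real.rpow_sub hpos, Real.rpow_two]
    field_simp
  set H : E → ℝ := fun x => ∑ i, m i * |inner ℝ x (y i)| ^ p with hH
  have hHx : ∀ x, ‖x‖ ^ p ≤ H x := by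
    intro x
    have h := Real.rpow_arith_mean_le_arith_mean_rpow Finset.univ m
      (fun i => inner ℝ x (y i) ^ 2) (fun i _ => hm0 i) hw1 (fun i _ => sq_nonneg _)
      (p := p / 2) (by linarith)
    have e : ∀ a : ℝ, (a ^ 2) ^ (p / 2) = |a| ^ p := fun a => by
      rw [← sq_abs, ← Real.rpow_natCast, ← Real.rpow_mul (abs_nonneg a)]
      congr 1
      push_cast
      ring
    rw [← hnorm, e, abs_norm] at h
    simpa only [e] using h
  set J : Finset (Fin N) := Finset.univ.filter fun i => m i ≤ 4 / N with hJ
  set T : Finset (Fin N) := Finset.univ.filter fun i => ¬ m i ≤ 4 / N with hT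
  have hcard : (J.card : ℝ) + T.card = N := by
    have := Finset.card_filter_add_card_filter_not (s := (Finset.univ : Finset (Fin N)))
      (fun i => m i ≤ 4 / N)
    rw [Finset.card_univ, Fintype.card_fin] at this
    exact_mod_cast this
  have hTcard : 4 * (T.card : ℝ) ≤ N := by
    have h1 : (T.card : ℝ) * (4 / N) ≤ 1 := by
      rw [← hw1, ← nsmul_eq_mul]
      refine (Finset.card_nsmul_le_sum T m _ fun i hi => ?_).trans
        (Finset.sum_le_univ_sum_of_nonneg hm0)
      exact (not_le.1 (Finset.mem_filter.1 hi).2).le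
    have : (T.card : ℝ) * (4 / N) * N ≤ 1 * N := by gcongr
    field_simp at this
    linarith
  set m' : Fin N → ℝ := fun i => if m i ≤ 4 / N then m i else 0 with hm'
  have hm'm : ∀ i, m' i ≤ m i := fun i => by
    simp only [hm']
    split_ifs
    exacts [le_rfl, hm0 i]
  have hm'0 : ∀ i, 0 ≤ m' i := fun i => by
    simp only [hm']
    split_ifs
    exacts [hm0 i, le_rfl]
  obtain ⟨ε, hε, hεJ, hεB⟩ := exists_signs_chaining hfin hp hrn hn hnN hN m' hm'0
    (fun i => by
      simp only [hm']
      split_ifs with h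
      exacts [h, by positivity])
    ((Finset.sum_le_sum fun i _ => hm'm i).trans hw1.le) y
    (fun i => by
      have h1 : ‖(‖w i‖⁻¹ • w i)‖ ≤ 1 := by
        rw [norm_smul, norm_inv, norm_norm]
        exact inv_mul_le_one
      have h2 : √(r : ℝ) ≤ √n := Real.sqrt_le_sqrt (by exact_mod_cast hrn)
      rw [hy, norm_smul, Real.norm_of_nonneg (Real.sqrt_nonneg _)]
      nlinarith [Real.sqrt_nonneg (r : ℝ)])
    {x | H x ≤ 1}
    (by simp [hH, Real.zero_rpow hp0])
    (fun x hx => by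
      by_contra! hlt
      have := (Real.one_lt_rpow hlt (by linarith : 0 < p)).trans_le ((hHx x).trans hx)
      exact lt_irrefl _ this)
    (fun x hx => (Finset.sum_le_sum fun i _ =>
      mul_le_mul_of_nonneg_right (hm'm i) (by positivity)).trans hx) J
  have hεJ' := abs_le.1 hεJ
  have hcount : ∀ (σ : ℝ) (P : Fin N → Prop) [DecidablePred P], |σ| = 1 →
      (∀ i, P i → m i ≤ 4 / N → ε i = σ) →
      8 * ((Finset.univ.filter P).card : ℝ) ≤ 7 * N := by
    intro σ P _ hσ hP
    have hσε : ∀ i, 0 ≤ 1 + σ * ε i := fun i => by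
      rcases hε i with h | h <;> rw [h] <;> nlinarith [abs_le.1 hσ.le]
    have h1 : ((Finset.univ.filter P).card : ℝ) ≤ (∑ i ∈ J, (1 + σ * ε i) / 2) + T.card := by
      have h2 : Finset.univ.filter P ⊆ (J.filter P) ∪ T := fun i hi => by
        simp only [hJ, hT, Finset.mem_union, Finset.mem_filter, Finset.mem_univ, true_and] at hi ⊢
        tauto
      have h3 := (Finset.card_le_card h2).trans (Finset.card_union_le _ _)
      have h4 : ((J.filter P).card : ℝ) ≤ ∑ i ∈ J, (1 + σ * ε i) / 2 := by
        rw [Finset.card_filter]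
        push_cast
        refine Finset.sum_le_sum fun i hi => ?_
        split_ifs with h
        · rw [hP i h (Finset.mem_filter.1 hi).2, ← sq, ← sq_abs, hσ]
          norm_num
        · linarith [hσε i]
      have h5 : ((Finset.univ.filter P).card : ℝ) ≤ (J.filter P).card + T.card := by
        exact_mod_cast h3
      linarith
    have h2 : ∑ i ∈ J, (1 + σ * ε i) / 2 = (J.card + σ * ∑ i ∈ J, ε i) / 2 := by
      rw [← Finset.sum_div, Finset.sum_add_distrib, ← Finset.mul_sum]
      simp
    have h3 : σ * ∑ i ∈ J, ε i ≤ N / 2 := by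
      refine (le_abs_self _).trans ?_
      rwa [abs_mul, hσ, one_mul]
    linarith
  refine ⟨fun i => if m i ≤ 4 / N then (1 + ε i) / 2 else 1 / 2, fun i => ?_,
    hcount 1 _ (by norm_num) fun i hi hmi => ?_, hcount (-1) _ (by norm_num) fun i hi hmi => ?_,
    fun x => ?_⟩
  · dsimp only
    split_ifs
    · rcases hε i with h | h <;> rw [h] <;> norm_num
    · norm_num
  · rcases hε i with h | h
    · exact h
    · simp [hmi, h] at hi
  · rcases hε i with h | h
    · simp [hmi, h] at hi
    · exact h
  set D := 300 * p * √((n : ℝ) ^ (p / 2) / N) * Real.log n * √(Real.log N)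
  have hsum : ∀ x, ∑ i, (2 * (if m i ≤ 4 / N then (1 + ε i) / 2 else 1 / 2) - 1) *
      (m i * |inner ℝ x (y i)| ^ p) = ∑ i, ε i * (m' i * |inner ℝ x (y i)| ^ p) := fun x =>
    Finset.sum_congr rfl fun i _ => by
      simp only [hm']
      split_ifs <;> ring
  have hmain : |∑ i, ε i * (m' i * |inner ℝ x (y i)| ^ p)| ≤ D * H x := by
    by_cases hx0 : x = 0
    · simp [hx0, hH, Real.zero_rpow hp0]
    have hHpos : 0 < H x := lt_of_lt_of_le (by have := norm_pos_iff.2 hx0; positivity) (hHx x)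
    set t : ℝ := (H x) ^ (-(1 / p)) with ht
    have htpos : 0 < t := by positivity
    have htp : t ^ p = (H x)⁻¹ := by
      rw [ht, ← Real.rpow_mul hHpos.le, ← Real.rpow_neg_one]
      congr 1
      field_simp
    have hin : ∀ i, |inner ℝ (t • x) (y i)| ^ p = t ^ p * |inner ℝ x (y i)| ^ p := fun i => by
      rw [real_inner_smul_left, abs_mul, abs_of_pos htpos,
        Real.mul_rpow htpos.le (abs_nonneg _)]
    have hmem : t • x ∈ {x | H x ≤ 1} := by
      have : H (t • x) = t ^ p * H x := by
        simp only [hH, hin, Finset.mul_sum]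
        exact Finset.sum_congr rfl fun i _ => by ring
      rw [Set.mem_ofPred_eq, this, htp, inv_mul_cancel₀ hHpos.ne']
    have h := hεB _ hmem
    have e : ∑ i, ε i * (m' i * |inner ℝ (t • x) (y i)| ^ p) =
        t ^ p * ∑ i, ε i * (m' i * |inner ℝ x (y i)| ^ p) := by
      simp only [hin, Finset.mul_sum]
      exact Finset.sum_congr rfl fun i _ => by ring
    rw [e, abs_mul, abs_of_nonneg (by positivity), htp, inv_mul_le_iff₀ hHpos] at h
    linarith
  rw [← hsum] at hmain
  simp only [hH, hmy] at hmain
  have hrp : 0 < (r : ℝ) ^ (p / 2) := by positivity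
  refine le_of_mul_le_mul_left ?_ hrp
  calc _ = |∑ i, (2 * (if m i ≤ 4 / N then (1 + ε i) / 2 else 1 / 2) - 1) *
      ((r : ℝ) ^ (p / 2) * |inner ℝ x (w i)| ^ p)| := by
        rw [← abs_of_pos hrp, ← abs_mul, abs_of_pos hrp, Finset.mul_sum]
        exact congrArg _ (Finset.sum_congr rfl fun i _ => by ring)
    _ ≤ _ := hmain
    _ = _ := by
      rw [← Finset.mul_sum]
      ring

lemma exists_weights_of_span_eq_top {E : Type*} [NormedAddCommGroup E]
    [InnerProductSpace ℝ E] [FiniteDimensional ℝ E] {r n N : ℕ}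
    (hfin : Module.finrank ℝ E = r) {p : ℝ} (hp : 2 < p) (hr : 0 < r) (hrn : r ≤ n)
    (hn : 2 ≤ n) (hnN : n ≤ N) (hN : 32 ≤ N) (z : Fin N → E)
    (hz : Submodule.span ℝ (Set.range z) = ⊤) :
    ∃ θ : Fin N → ℝ, (∀ i, 0 ≤ θ i ∧ θ i ≤ 1) ∧
      8 * ((Finset.univ.filter fun i => θ i ≠ 0).card : ℝ) ≤ 7 * N ∧
      8 * ((Finset.univ.filter fun i => θ i ≠ 1).card : ℝ) ≤ 7 * N ∧
      ∀ x, |∑ i, (2 * θ i - 1) * |inner ℝ x (z i)| ^ p| ≤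
        300 * p * √((n : ℝ) ^ (p / 2) / N) * Real.log n * √(Real.log N) *
          ∑ i, |inner ℝ x (z i)| ^ p := by
  obtain ⟨A, hdet, hA1, hA2⟩ := exists_lewis_position hfin hp hr z hz
  obtain ⟨θ, h0, h1, h2, h3⟩ :=
    exists_weights_of_lewis_position hfin hp hrn hn hnN hN (fun i => A (z i)) hA1 hA2
  refine ⟨θ, h0, h1, h2, fun x => ?_⟩
  let L : E ≃ₗ[ℝ] E := (A : E →ₗ[ℝ] E).equivOfDetNeZero hdet
  have hL : ∀ v, L.symm (A v) = v := fun v => L.symm_apply_apply v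
  have hin : ∀ i, inner ℝ (LinearMap.adjoint (L.symm : E →ₗ[ℝ] E) x) (A (z i)) =
      inner ℝ x (z i) := fun i => by
    rw [LinearMap.adjoint_inner_left, LinearEquiv.coe_coe, hL]
  simpa only [hin] using h3 (LinearMap.adjoint (L.symm : E →ₗ[ℝ] E) x)

lemma exists_half_weights {N : ℕ} (hN : 2 ≤ N) :
    ∃ θ : Fin N → ℝ, (∀ i, 0 ≤ θ i ∧ θ i ≤ 1) ∧
      8 * ((Finset.univ.filter fun i => θ i ≠ 0).card : ℝ) ≤ 7 * N ∧
      8 * ((Finset.univ.filter fun i => θ i ≠ 1).card : ℝ) ≤ 7 * N ∧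
      ∀ g : Fin N → ℝ, (∀ i, 0 ≤ g i) → |∑ i, (2 * θ i - 1) * g i| ≤ ∑ i, g i := by
  have hc : (Finset.univ.filter fun i : Fin N => i.1 < N / 2).card = N / 2 := by
    rw [Fin.card_filter_val_lt]
    omega
  have hc' : (Finset.univ.filter fun i : Fin N => ¬ i.1 < N / 2).card = N - N / 2 := by
    have := Finset.card_filter_add_card_filter_not (s := (Finset.univ : Finset (Fin N)))
      (fun i => i.1 < N / 2)
    rw [Finset.card_univ, Fintype.card_fin] at this
    omega
  refine ⟨fun i => if i.1 < N / 2 then 1 else 0, fun i => ?_, ?_, ?_, fun g hg => ?_⟩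
  · dsimp only
    split_ifs <;> norm_num
  · have : (Finset.univ.filter fun i : Fin N => (if i.1 < N / 2 then (1 : ℝ) else 0) ≠ 0) =
        Finset.univ.filter fun i : Fin N => i.1 < N / 2 :=
      Finset.filter_congr fun i _ => by split_ifs with h <;> simp [h]
    rw [this, hc]
    norm_cast
    omega
  · have : (Finset.univ.filter fun i : Fin N => (if i.1 < N / 2 then (1 : ℝ) else 0) ≠ 1) =
        Finset.univ.filter fun i : Fin N => ¬ i.1 < N / 2 :=
      Finset.filter_congr fun i _ => by split_ifs with h <;> simp [h]
    rw [this, hc']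
    norm_cast
    omega
  · refine (Finset.abs_sum_le_sum_abs _ _).trans (Finset.sum_le_sum fun i _ => ?_)
    rw [abs_mul, abs_of_nonneg (hg i)]
    dsimp only
    split_ifs <;> norm_num

lemma exists_weights {E : Type*} [NormedAddCommGroup E]
    [InnerProductSpace ℝ E] [FiniteDimensional ℝ E] {n N : ℕ}
    (hfin : Module.finrank ℝ E ≤ n) {p : ℝ} (hp : 2 < p)
    (hn : 2 ≤ n) (hnN : n ≤ N) (z : Fin N → E) :
    ∃ θ : Fin N → ℝ, (∀ i, 0 ≤ θ i ∧ θ i ≤ 1) ∧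
      8 * ((Finset.univ.filter fun i => θ i ≠ 0).card : ℝ) ≤ 7 * N ∧
      8 * ((Finset.univ.filter fun i => θ i ≠ 1).card : ℝ) ≤ 7 * N ∧
      ∀ x, |∑ i, (2 * θ i - 1) * |inner ℝ x (z i)| ^ p| ≤
        300 * p * √((n : ℝ) ^ (p / 2) / N) * Real.log n * √(Real.log N) *
          ∑ i, |inner ℝ x (z i)| ^ p := by
  have hn' : (2 : ℝ) ≤ n := by exact_mod_cast hn
  have hN' : (2 : ℝ) ≤ N := by exact_mod_cast hn.trans hnN
  have hlogn : 0.69 ≤ Real.log n :=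
    (by linarith [Real.log_two_gt_d9] : (0.69 : ℝ) ≤ Real.log 2).trans
      (Real.log_le_log two_pos hn')
  have hlogN : 0.69 ≤ Real.log N :=
    (by linarith [Real.log_two_gt_d9] : (0.69 : ℝ) ≤ Real.log 2).trans
      (Real.log_le_log two_pos hN')
  rcases Nat.lt_or_ge N 32 with hN | hN
  · obtain ⟨θ, h0, h1, h2, h3⟩ := exists_half_weights (hn.trans hnN)
    refine ⟨θ, h0, h1, h2, fun x => (h3 _ fun i => by positivity).trans ?_⟩
    refine le_mul_of_one_le_left (by positivity) ?_
    have ha : (1 / 4 : ℝ) ≤ √((n : ℝ) ^ (p / 2) / N) := by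
      refine Real.le_sqrt_of_sq_le ?_
      have h4 : (2 : ℝ) ≤ (n : ℝ) ^ (p / 2) :=
        hn'.trans (Real.self_le_rpow_of_one_le (by linarith) (by linarith))
      have h5 : (N : ℝ) ≤ 32 := by exact_mod_cast hN.le
      rw [le_div_iff₀ (by linarith)]
      linarith
    have hb : (1 / 2 : ℝ) ≤ √(Real.log N) := Real.le_sqrt_of_sq_le (by linarith)
    calc (1 : ℝ) ≤ 300 * 2 * (1 / 4) * 0.69 * (1 / 2) := by norm_num
      _ ≤ _ := by gcongr
  set W : Submodule ℝ E := Submodule.span ℝ (Set.range z)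
  let z' : Fin N → W := fun i => ⟨z i, Submodule.subset_span (Set.mem_range_self i)⟩
  rcases Nat.eq_zero_or_pos (Module.finrank ℝ W) with hr | hr
  · obtain ⟨θ, h0, h1, h2, h3⟩ := exists_half_weights (hn.trans hnN)
    have hz : ∀ i, z i = 0 := fun i => by
      have := Module.finrank_zero_iff.1 hr
      exact congrArg Subtype.val (Subsingleton.elim (z' i) 0)
    refine ⟨θ, h0, h1, h2, fun x => ?_⟩
    have hp0 : p ≠ 0 := by linarith
    simp [hz, Real.zero_rpow hp0]
  have hspan : Submodule.span ℝ (Set.range z') = ⊤ := by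
    have : Set.range z' = ((↑) : W → E) ⁻¹' Set.range z := by
      ext v
      simp [z', Subtype.ext_iff]
    rw [this]
    exact Submodule.span_span_coe_preimage
  obtain ⟨θ, h0, h1, h2, h3⟩ := exists_weights_of_span_eq_top rfl hp hr
    ((Submodule.finrank_le W).trans hfin) hn hnN hN z' hspan
  refine ⟨θ, h0, h1, h2, fun x => ?_⟩
  have hin : ∀ i, inner ℝ (W.orthogonalProjectionOnto x) (z' i) = inner ℝ x (z i) := fun i => by
    rw [real_inner_comm, real_inner_comm (z i)]
    exact Submodule.inner_orthogonalProjectionOnto_eq_of_mem_left (z' i) x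
  simpa only [hin] using h3 (W.orthogonalProjectionOnto x)

lemma extend_zero_of_notMem_range {ι κ M : Type*} [Zero M] {e : ι → κ} (g : ι → M) {j : κ}
    (hj : j ∉ Set.range e) : Function.extend e g 0 j = 0 := by
  rw [Function.extend_apply' _ _ _ hj, Pi.zero_apply]

lemma bddAbove_range_abs {k : ℕ} (x : Fin k → ℝ) : BddAbove (Set.range fun i => |x i|) :=
  (Set.finite_range _).bddAbove

lemma abs_le_supNormFin {k : ℕ} (x : Fin k → ℝ) (i : Fin k) : |x i| ≤ supNormFin x :=
  le_csSup (bddAbove_range_abs x) (Set.mem_range_self i)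

lemma supNormFin_le {k : ℕ} {x : Fin k → ℝ} {a : ℝ} (ha : 0 ≤ a) (h : ∀ i, |x i| ≤ a) :
    supNormFin x ≤ a :=
  Real.sSup_le (by rintro _ ⟨i, rfl⟩; exact h i) ha

lemma supNormFin_nonneg {k : ℕ} (x : Fin k → ℝ) : 0 ≤ supNormFin x :=
  Real.sSup_nonneg (by rintro _ ⟨i, rfl⟩; exact abs_nonneg _)

lemma lqNormFin_nonneg {q : ℝ} {k : ℕ} (x : Fin k → ℝ) : 0 ≤ lqNormFin q x :=
  Real.rpow_nonneg (Finset.sum_nonneg fun _ _ => by positivity) _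

lemma lqNormFin_mono {q : ℝ} (hq : 0 < q) {k : ℕ} {x y : Fin k → ℝ} (h : ∀ i, |x i| ≤ |y i|) :
    lqNormFin q x ≤ lqNormFin q y :=
  Real.rpow_le_rpow (Finset.sum_nonneg fun _ _ => by positivity)
    (Finset.sum_le_sum fun i _ => Real.rpow_le_rpow (abs_nonneg _) (h i) hq.le) (by positivity)

lemma sum_rpow_le_one_of_lqNormFin_le_one {q : ℝ} (hq : 0 < q) {k : ℕ} {x : Fin k → ℝ}
    (h : lqNormFin q x ≤ 1) : ∑ i, |x i| ^ q ≤ 1 := by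
  by_contra! hlt
  exact (Real.one_lt_rpow hlt (by positivity : 0 < 1 / q)).not_ge h

lemma abs_le_one_of_lqNormFin_le_one {q : ℝ} (hq : 0 < q) {k : ℕ} {x : Fin k → ℝ}
    (h : lqNormFin q x ≤ 1) (i : Fin k) : |x i| ≤ 1 := by
  by_contra! hlt
  have h1 : 1 < |x i| ^ q := Real.one_lt_rpow hlt hq
  have h2 : |x i| ^ q ≤ ∑ i, |x i| ^ q :=
    Finset.single_le_sum (f := fun i => |x i| ^ q) (fun _ _ => by positivity)
      (Finset.mem_univ i)
  linarith [sum_rpow_le_one_of_lqNormFin_le_one hq h]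

section nuQ

variable {X Y : Type*} [NormedAddCommGroup X] [NormedSpace ℝ X] [NormedAddCommGroup Y]
  [NormedSpace ℝ Y]

lemma zero_mem_lowerBounds_nuQ (q : ℝ) (k : ℕ) (v : X →ₗ[ℝ] Y) :
    0 ∈ lowerBounds { r : ℝ | ∃ (A : X →ₗ[ℝ] (Fin k → ℝ)) (d : Fin k → ℝ)
      (B : (Fin k → ℝ) →ₗ[ℝ] Y),
      v = B ∘ₗ (LinearMap.pi fun i => d i • LinearMap.proj i) ∘ₗ A ∧
      r = sSup {a | ∃ x : X, ‖x‖ ≤ 1 ∧ a = supNormFin (A x)} *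
        sSup {a | ∃ x : Fin k → ℝ, supNormFin x ≤ 1 ∧ a = lqNormFin q fun i => d i * x i} *
        sSup {a | ∃ x : Fin k → ℝ, lqNormFin q x ≤ 1 ∧ a = ‖B x‖} } := by
  rintro _ ⟨A, d, B, -, rfl⟩
  refine mul_nonneg (mul_nonneg ?_ ?_) ?_ <;> refine Real.sSup_nonneg ?_
  · rintro _ ⟨x, -, rfl⟩
    exact supNormFin_nonneg _
  · rintro _ ⟨x, -, rfl⟩
    exact lqNormFin_nonneg _
  · rintro _ ⟨x, -, rfl⟩
    exact norm_nonneg _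

lemma nuQ_nonneg (q : ℝ) (k : ℕ) (v : X →ₗ[ℝ] Y) : 0 ≤ nuQ q k v :=
  Real.sInf_nonneg fun _ hr => zero_mem_lowerBounds_nuQ q k v hr

lemma nuQ_le {p q : ℝ} (hpq : p.HolderConjugate q) {k N : ℕ} (v : X →ₗ[ℝ] Y)
    (a : X →ₗ[ℝ] (Fin N → ℝ)) (c : Fin N → ℝ) (b : Fin N → Y) (S : Finset (Fin N))
    (hS : S.card ≤ k) (hc : ∀ i ∉ S, c i = 0) (hv : ∀ x, v x = ∑ i, (c i * a x i) • b i)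
    {α β : ℝ} (hα : 0 ≤ α) (hβ : 0 ≤ β) (ha : ∀ x, ‖x‖ ≤ 1 → ∀ i, |a x i| ≤ α)
    (hb : ∀ f : StrongDual ℝ Y, ‖f‖ ≤ 1 → ∑ i, |f (b i)| ^ p ≤ β ^ p) :
    nuQ q k v ≤ α * (∑ i, |c i| ^ q) ^ (1 / q) * β := by
  have hp := hpq.pos
  have hq := hpq.symm.pos
  obtain ⟨e⟩ : Nonempty (S ↪ Fin k) :=
    Function.Embedding.nonempty_of_card_le (by simpa using hS)
  set A : X →ₗ[ℝ] (Fin k → ℝ) :=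
    LinearMap.pi (Function.extend e (fun i : S => LinearMap.proj i.1 ∘ₗ a) 0) with hA
  set d : Fin k → ℝ := Function.extend e (fun i : S => c i.1) 0 with hd
  set b' : Fin k → Y := Function.extend e (fun i : S => b i.1) 0 with hb'
  refine (csInf_le ⟨0, zero_mem_lowerBounds_nuQ q k v⟩
    ⟨A, d, Fintype.linearCombination ℝ b', ?_, rfl⟩).trans ?_
  · ext x
    rw [hv, ← Finset.sum_subset (Finset.subset_univ S) fun i _ hi => by simp [hc i hi],
      ← Finset.sum_coe_sort S]
    simp only [LinearMap.comp_apply, Fintype.linearCombination_apply, LinearMap.pi_apply,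
      LinearMap.smul_apply, LinearMap.proj_apply, smul_eq_mul]
    refine Fintype.sum_of_injective e e.injective _ _ (fun j hj => ?_) fun i => ?_
    · simp only [hb']
      rw [extend_zero_of_notMem_range _ hj, smul_zero]
    · simp only [hb', hd, hA, LinearMap.pi_apply]
      rw [e.injective.extend_apply, e.injective.extend_apply, e.injective.extend_apply]
      rfl
  have hsum : ∀ f : Fin k → ℝ, ∀ g : Fin N → ℝ, (∀ j ∉ Set.range e, f j = 0) →
      (∀ i : S, f (e i) = g i) → (∀ i, 0 ≤ g i) → ∑ j, f j ≤ ∑ i, g i := by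
    intro f g h0 h1 h2
    rw [← Fintype.sum_of_injective e e.injective (fun i : S => g i) f h0 fun i => (h1 i).symm,
      Finset.sum_coe_sort S]
    exact Finset.sum_le_univ_sum_of_nonneg h2
  have hD : 0 ≤ (∑ i, |c i| ^ q) ^ (1 / q) := by positivity
  have hA' : sSup {r | ∃ x : X, ‖x‖ ≤ 1 ∧ r = supNormFin (A x)} ≤ α := by
    refine Real.sSup_le ?_ hα
    rintro _ ⟨x, hx, rfl⟩
    refine supNormFin_le hα fun j => ?_
    simp only [hA, LinearMap.pi_apply]
    by_cases hj : j ∈ Set.range e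
    · obtain ⟨i, rfl⟩ := hj
      rw [e.injective.extend_apply]
      exact ha x hx i
    · rw [extend_zero_of_notMem_range _ hj]
      simpa using hα
  have hd' : sSup {r | ∃ x : Fin k → ℝ, supNormFin x ≤ 1 ∧
      r = lqNormFin q fun i => d i * x i} ≤ (∑ i, |c i| ^ q) ^ (1 / q) := by
    refine Real.sSup_le ?_ hD
    rintro _ ⟨x, hx, rfl⟩
    refine (lqNormFin_mono hq (y := d) fun j => ?_).trans ?_
    · rw [abs_mul]
      exact mul_le_of_le_one_right (abs_nonneg _) ((abs_le_supNormFin x j).trans hx)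
    · refine Real.rpow_le_rpow (by positivity) (hsum _ _ (fun j hj => ?_) (fun i => ?_)
        fun i => by positivity) (by positivity)
      · rw [hd, extend_zero_of_notMem_range _ hj, abs_zero, Real.zero_rpow hq.ne']
      · rw [hd, e.injective.extend_apply]
  have hB' : sSup {r | ∃ x : Fin k → ℝ, lqNormFin q x ≤ 1 ∧
      r = ‖Fintype.linearCombination ℝ b' x‖} ≤ β := by
    refine Real.sSup_le ?_ hβ
    rintro _ ⟨x, hx, rfl⟩
    obtain ⟨f, hf1, hf2⟩ := exists_dual_vector'' ℝ (Fintype.linearCombination ℝ b' x)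
    have h1 : ‖Fintype.linearCombination ℝ b' x‖ = ∑ j, f (b' j) * x j := by
      rw [show (‖Fintype.linearCombination ℝ b' x‖ : ℝ) =
        f (Fintype.linearCombination ℝ b' x) from hf2.symm, Fintype.linearCombination_apply,
        map_sum]
      exact Finset.sum_congr rfl fun j _ => by rw [map_smul, smul_eq_mul, mul_comm]
    have h2 : ∑ j, |f (b' j)| ^ p ≤ β ^ p := by
      refine (hsum _ (fun i => |f (b i)| ^ p) (fun j hj => ?_) (fun i => ?_)
        fun i => by positivity).trans (hb f hf1)
      · rw [hb', extend_zero_of_notMem_range _ hj, map_zero, abs_zero, Real.zero_rpow hp.ne']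
      · rw [hb', e.injective.extend_apply]
    have h3 : (∑ j, |f (b' j)| ^ p) ^ (1 / p) ≤ β := by
      refine (Real.rpow_le_rpow (by positivity) h2 (by positivity)).trans ?_
      rw [← Real.rpow_mul hβ, mul_one_div_cancel hp.ne', Real.rpow_one]
    rw [h1]
    refine (Real.inner_le_Lp_mul_Lq Finset.univ _ _ hpq).trans ?_
    refine (mul_le_mul h3 hx (lqNormFin_nonneg x) hβ).trans (mul_one β).le
  refine mul_le_mul (mul_le_mul hA' hd' ?_ hα) hB' ?_ (by positivity) <;>
    refine Real.sSup_nonneg ?_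
  · rintro _ ⟨x, -, rfl⟩
    exact lqNormFin_nonneg _
  · rintro _ ⟨x, -, rfl⟩
    exact norm_nonneg _

lemma nuQSplit_one (q : ℝ) (k : ℕ) (v : X →ₗ[ℝ] Y) : nuQSplit q k 1 v = nuQ q k v := by
  have : { r : ℝ | ∃ u : Fin 1 → (X →ₗ[ℝ] Y), v = ∑ i, u i ∧ r = ∑ i, nuQ q k (u i) } =
      {nuQ q k v} := by
    ext r
    simp only [Fin.sum_univ_one, Set.mem_ofPred_eq, Set.mem_singleton_iff]
    constructor
    · rintro ⟨u, rfl, rfl⟩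
      rfl
    · rintro rfl
      exact ⟨fun _ => v, rfl, rfl⟩
  rw [nuQSplit, this, csInf_singleton]

lemma nuQSplit_two_le (q : ℝ) (k : ℕ) (v v₁ v₂ : X →ₗ[ℝ] Y) (h : v = v₁ + v₂) :
    nuQSplit q k 2 v ≤ nuQ q k v₁ + nuQ q k v₂ := by
  refine csInf_le ⟨0, ?_⟩ ⟨![v₁, v₂], ?_, ?_⟩
  · rintro _ ⟨u, -, rfl⟩
    exact Finset.sum_nonneg fun i _ => nuQ_nonneg _ _ _
  · simpa using h
  · simp

lemma exists_factorization [FiniteDimensional ℝ Y] {N : ℕ} (hN : Module.finrank ℝ Y ≤ N)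
    (u : X →ₗ[ℝ] Y) : ∃ (A : X →ₗ[ℝ] (Fin N → ℝ)) (B : (Fin N → ℝ) →ₗ[ℝ] Y),
      u = B ∘ₗ (LinearMap.pi fun i => (1 : ℝ) • LinearMap.proj i) ∘ₗ A := by
  let e : (Fin (Module.finrank ℝ Y) → ℝ) ≃ₗ[ℝ] Y := (Module.finBasis ℝ Y).equivFun.symm
  let B : (Fin N → ℝ) →ₗ[ℝ] Y := e.toLinearMap ∘ₗ LinearMap.funLeft ℝ ℝ (Fin.castLE hN)
  have hB : Function.Surjective B := e.surjective.comp
    (LinearMap.funLeft_surjective_of_injective ℝ ℝ _ (Fin.castLE_injective hN))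
  obtain ⟨g, hg⟩ := LinearMap.exists_rightInverse_of_surjective B (LinearMap.range_eq_top.2 hB)
  refine ⟨g ∘ₗ u, B, ?_⟩
  ext x
  have := LinearMap.congr_fun hg (u x)
  simp only [LinearMap.comp_apply, LinearMap.id_apply] at this
  rw [LinearMap.comp_apply, LinearMap.comp_apply]
  conv_lhs => rw [← this]
  refine congrArg B (funext fun i => ?_)
  simp

/-- The functionals of norm at most one on the images of the unit vectors under
`B : ℓ_q^N → Y` have `ℓ_p`-norm at most `‖B‖`. -/
lemma sum_abs_apply_single_rpow_le {p q : ℝ} (hpq : p.HolderConjugate q) {N : ℕ}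
    (B : (Fin N → ℝ) →ₗ[ℝ] Y) {β : ℝ} (hB : ∀ x, lqNormFin q x ≤ 1 → ‖B x‖ ≤ β)
    (f : StrongDual ℝ Y) (hf : ‖f‖ ≤ 1) :
    ∑ i, |f (B (Pi.single i 1))| ^ p ≤ β ^ p := by
  have hp := hpq.pos
  have hq := hpq.symm.pos
  set φ : Fin N → ℝ := fun i => f (B (Pi.single i 1)) with hφ
  obtain ⟨g, hg1, hg2⟩ := (NNReal.isGreatest_Lp Finset.univ
    (fun i => Real.nnabs (φ i)) hpq).1
  set x : Fin N → ℝ := fun i => SignType.sign (φ i) * (g i : ℝ) with hx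
  have hxg : ∀ i, |x i| ≤ g i := fun i => by
    rw [hx, abs_mul, NNReal.abs_eq]
    refine mul_le_of_le_one_left (g i).2 ?_
    rcases lt_trichotomy (φ i) 0 with h | h | h <;> simp [h]
  have hx1 : lqNormFin q x ≤ 1 := by
    refine Real.rpow_le_one (by positivity) ?_ (by positivity)
    have h1 : ∑ i, (g i : ℝ) ^ q ≤ 1 := by exact_mod_cast hg1
    exact (Finset.sum_le_sum fun i _ =>
      Real.rpow_le_rpow (abs_nonneg _) (hxg i) hq.le).trans h1
  have hfB : f (B x) = ∑ i, |φ i| * g i := by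
    have h1 : x = ∑ i, x i • (Pi.single i 1 : Fin N → ℝ) := by
      simp [← Pi.single_smul, Finset.univ_sum_single]
    conv_lhs => rw [h1]
    rw [map_sum, map_sum]
    refine Finset.sum_congr rfl fun i _ => ?_
    rw [map_smul, map_smul, smul_eq_mul]
    change x i * φ i = _
    rw [hx, mul_right_comm, ← sign_mul_self]
  have hval : (∑ i, |φ i| ^ p) ^ (1 / p) ≤ β := by
    have h1 : ((∑ i, |φ i| * g i : ℝ)) = (∑ i, |φ i| ^ p) ^ (1 / p) := by
      have := congrArg ((↑) : NNReal → ℝ) hg2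
      push_cast at this
      simpa using this
    rw [← h1, ← hfB]
    calc f (B x) ≤ ‖f (B x)‖ := Real.le_norm_self _
      _ ≤ ‖f‖ * ‖B x‖ := f.le_opNorm _
      _ ≤ 1 * β := mul_le_mul hf (hB x hx1) (norm_nonneg _) zero_le_one
      _ = β := one_mul β
  have h0 : 0 ≤ ∑ i, |φ i| ^ p := by positivity
  have := Real.rpow_le_rpow (by positivity) hval hp.le
  rwa [← Real.rpow_mul h0, one_div_mul_cancel hp.ne', Real.rpow_one] at this

lemma exists_weights_dual [FiniteDimensional ℝ Y] {n N : ℕ}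
    (hfin : Module.finrank ℝ Y ≤ n) {p : ℝ} (hp : 2 < p)
    (hn : 2 ≤ n) (hnN : n ≤ N) (b : Fin N → Y) :
    ∃ θ : Fin N → ℝ, (∀ i, 0 ≤ θ i ∧ θ i ≤ 1) ∧
      8 * ((Finset.univ.filter fun i => θ i ≠ 0).card : ℝ) ≤ 7 * N ∧
      8 * ((Finset.univ.filter fun i => θ i ≠ 1).card : ℝ) ≤ 7 * N ∧
      ∀ f : StrongDual ℝ Y, |∑ i, (2 * θ i - 1) * |f (b i)| ^ p| ≤
        300 * p * √((n : ℝ) ^ (p / 2) / N) * Real.log n * √(Real.log N) *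
          ∑ i, |f (b i)| ^ p := by
  let e : Y ≃ₗ[ℝ] EuclideanSpace ℝ (Fin (Module.finrank ℝ Y)) :=
    LinearEquiv.ofFinrankEq _ _ (by simp)
  obtain ⟨θ, h0, h1, h2, h3⟩ := exists_weights
    (E := EuclideanSpace ℝ (Fin (Module.finrank ℝ Y))) (by simpa using hfin) hp hn hnN
    (fun i => e (b i))
  refine ⟨θ, h0, h1, h2, fun f => ?_⟩
  let F : StrongDual ℝ (EuclideanSpace ℝ (Fin (Module.finrank ℝ Y))) :=
    LinearMap.toContinuousLinearMap ((f : Y →ₗ[ℝ] ℝ) ∘ₗ (e.symm : _ →ₗ[ℝ] Y))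
  have hin : ∀ i, inner ℝ ((InnerProductSpace.toDual ℝ _).symm F) (e (b i)) = f (b i) :=
    fun i => by
      rw [InnerProductSpace.toDual_symm_apply]
      simp [F]
  simpa only [hin] using h3 ((InnerProductSpace.toDual ℝ _).symm F)

lemma nuQ_weighted_le {p q : ℝ} (hpq : p.HolderConjugate q) {k N : ℕ} (v : X →ₗ[ℝ] Y)
    (a : X →ₗ[ℝ] (Fin N → ℝ)) (d : Fin N → ℝ) (b : Fin N → Y) (θ : Fin N → ℝ)
    (hθ : ∀ i, 0 ≤ θ i) (hk : (Finset.univ.filter fun i => θ i ≠ 0).card ≤ k)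
    (hv : ∀ x, v x = ∑ i, (θ i * (d i * a x i)) • b i)
    {α β s : ℝ} (hα : 0 ≤ α) (hβ : 0 ≤ β) (hs : 0 ≤ s)
    (ha : ∀ x, ‖x‖ ≤ 1 → ∀ i, |a x i| ≤ α)
    (hb : ∀ f : StrongDual ℝ Y, ‖f‖ ≤ 1 → ∑ i, |f (b i)| ^ p ≤ β ^ p)
    (hθb : ∀ f : StrongDual ℝ Y, ∑ i, θ i * |f (b i)| ^ p ≤ s * ∑ i, |f (b i)| ^ p) :
    nuQ q k v ≤ α * (∑ i, θ i * |d i| ^ q) ^ (1 / q) * (s ^ (1 / p) * β) := by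
  have hp := hpq.pos
  have hq := hpq.symm.pos
  have hmul : ∀ i, θ i ^ (1 / q) * θ i ^ (1 / p) = θ i := fun i => by
    rw [← Real.rpow_add_of_nonneg (hθ i) (by positivity) (by positivity), add_comm,
      one_div, one_div, hpq.inv_add_inv_eq_one, Real.rpow_one]
  have hpow : ∀ {t : ℝ}, 0 < t → ∀ (i : Fin N) (c : ℝ),
      |θ i ^ (1 / t) * c| ^ t = θ i * |c| ^ t := fun {t} ht i c => by
    rw [abs_mul, abs_of_nonneg (Real.rpow_nonneg (hθ i) _),
      Real.mul_rpow (Real.rpow_nonneg (hθ i) _) (abs_nonneg c), ← Real.rpow_mul (hθ i),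
      one_div_mul_cancel ht.ne', Real.rpow_one]
  have h := nuQ_le (k := k) hpq v a (fun i => θ i ^ (1 / q) * d i)
    (fun i => θ i ^ (1 / p) • b i) (Finset.univ.filter fun i => θ i ≠ 0) hk
    (fun i hi => by
      have : θ i = 0 := by simpa using hi
      rw [this, Real.zero_rpow (by positivity), zero_mul])
    (fun x => by
      rw [hv]
      refine Finset.sum_congr rfl fun i _ => ?_
      rw [smul_smul]
      congr 1
      linear_combination (-(d i * a x i)) * hmul i)
    hα (mul_nonneg (Real.rpow_nonneg hs _) hβ) ha
    (fun f hf => by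
      simp only [map_smul, smul_eq_mul, hpow hp]
      rw [Real.mul_rpow (Real.rpow_nonneg hs _) hβ, ← Real.rpow_mul hs,
        one_div_mul_cancel hp.ne', Real.rpow_one]
      exact (hθb f).trans (mul_le_mul_of_nonneg_left (hb f hf) hs))
  simpa only [hpow hq] using h

lemma add_rpow_inv_le {p q : ℝ} (hpq : p.HolderConjugate q) {a b : ℝ} (ha : 0 ≤ a)
    (hb : 0 ≤ b) :
    a ^ (1 / q) + b ^ (1 / q) ≤ (2 : ℝ) ^ (1 / p) * (a + b) ^ (1 / q) := by
  have hq := hpq.symm.pos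
  have h := Real.inner_le_Lp_mul_Lq Finset.univ ![(1 : ℝ), 1] ![a ^ (1 / q), b ^ (1 / q)] hpq
  have e : ∀ c : ℝ, 0 ≤ c → |c ^ (1 / q)| ^ q = c := fun c hc => by
    rw [abs_of_nonneg (Real.rpow_nonneg hc _), ← Real.rpow_mul hc, one_div_mul_cancel hq.ne',
      Real.rpow_one]
  simp only [Fin.sum_univ_two, Matrix.cons_val_zero, Matrix.cons_val_one, one_mul, abs_one,
    Real.one_rpow, e a ha, e b hb] at h
  norm_num at h ⊢
  exact h

lemma nuQSplit_two_le_of_factorization [FiniteDimensional ℝ X] [FiniteDimensional ℝ Y]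
    {n N : ℕ} (hfin : Module.finrank ℝ Y ≤ n) {p q : ℝ} (hp : 2 < p)
    (hpq : p.HolderConjugate q) (hn : 2 ≤ n) (hnN : n ≤ N) (u : X →ₗ[ℝ] Y)
    (A : X →ₗ[ℝ] (Fin N → ℝ)) (d : Fin N → ℝ) (B : (Fin N → ℝ) →ₗ[ℝ] Y)
    (hu : u = B ∘ₗ (LinearMap.pi fun i => d i • LinearMap.proj i) ∘ₗ A) :
    nuQSplit q ⌈(7 * (N : ℝ)) / 8⌉₊ 2 u ≤
      (1 + 300 * p * √((n : ℝ) ^ (p / 2) / N) * Real.log n * √(Real.log N)) *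
        (sSup {a | ∃ x : X, ‖x‖ ≤ 1 ∧ a = supNormFin (A x)} *
        sSup {a | ∃ x : Fin N → ℝ, supNormFin x ≤ 1 ∧ a = lqNormFin q fun i => d i * x i} *
        sSup {a | ∃ x : Fin N → ℝ, lqNormFin q x ≤ 1 ∧ a = ‖B x‖}) := by
  have hq := hpq.symm.pos
  set α := sSup {a | ∃ x : X, ‖x‖ ≤ 1 ∧ a = supNormFin (A x)}
  set D := sSup {a | ∃ x : Fin N → ℝ, supNormFin x ≤ 1 ∧ a = lqNormFin q fun i => d i * x i}
  set β := sSup {a | ∃ x : Fin N → ℝ, lqNormFin q x ≤ 1 ∧ a = ‖B x‖}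
  set δ := 300 * p * √((n : ℝ) ^ (p / 2) / N) * Real.log n * √(Real.log N) with hδ
  have hα0 : 0 ≤ α := Real.sSup_nonneg (by rintro _ ⟨x, -, rfl⟩; exact supNormFin_nonneg _)
  have hβ0 : 0 ≤ β := Real.sSup_nonneg (by rintro _ ⟨x, -, rfl⟩; exact norm_nonneg _)
  have hδ0 : 0 ≤ δ := by
    have := Real.log_natCast_nonneg n
    have : 0 ≤ p := by linarith
    positivity
  have hα : ∀ x, ‖x‖ ≤ 1 → ∀ i, |A x i| ≤ α := by
    intro x hx i
    refine (abs_le_supNormFin (A x) i).trans (le_csSup ⟨‖A.toContinuousLinearMap‖, ?_⟩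
      ⟨x, hx, rfl⟩)
    rintro _ ⟨y, hy, rfl⟩
    refine supNormFin_le (norm_nonneg _) fun j => ?_
    exact (norm_le_pi_norm (A y) j).trans (A.toContinuousLinearMap.unit_le_opNorm y hy)
  have hβ : ∀ x, lqNormFin q x ≤ 1 → ‖B x‖ ≤ β := by
    intro x hx
    refine le_csSup ⟨‖B.toContinuousLinearMap‖, ?_⟩ ⟨x, hx, rfl⟩
    rintro _ ⟨y, hy, rfl⟩
    refine B.toContinuousLinearMap.unit_le_opNorm y ?_
    exact (pi_norm_le_iff_of_nonneg zero_le_one).2 (abs_le_one_of_lqNormFin_le_one hq hy)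
  have hD : (∑ i, |d i| ^ q) ^ (1 / q) ≤ D := by
    refine le_csSup ⟨lqNormFin q d, ?_⟩ ⟨fun _ => 1, ?_, ?_⟩
    · rintro _ ⟨x, hx, rfl⟩
      refine lqNormFin_mono hq fun j => ?_
      rw [abs_mul]
      exact mul_le_of_le_one_right (abs_nonneg _) ((abs_le_supNormFin x j).trans hx)
    · exact supNormFin_le zero_le_one fun i => by simp
    · simp [lqNormFin]
  set b : Fin N → Y := fun i => B (Pi.single i 1) with hb
  have hux : ∀ x, u x = ∑ i, (d i * A x i) • b i := by
    intro x
    have h1 : (LinearMap.pi fun i => d i • LinearMap.proj i : (Fin N → ℝ) →ₗ[ℝ] _) (A x) =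
        ∑ i, (d i * A x i) • (Pi.single i 1 : Fin N → ℝ) := by
      ext j
      simp [Finset.sum_apply, Pi.single_apply]
    rw [hu, LinearMap.comp_apply, LinearMap.comp_apply, h1, map_sum]
    simp [hb]
  have hbβ := sum_abs_apply_single_rpow_le hpq B hβ
  obtain ⟨θ, hθ, hθ0, hθ1, hθb⟩ := exists_weights_dual hfin hp hn hnN b
  rw [← hδ] at hθb
  have hceil : ∀ c : ℕ, 8 * (c : ℝ) ≤ 7 * N → c ≤ ⌈(7 * (N : ℝ)) / 8⌉₊ := fun c hc => by
    have h1 := Nat.le_ceil ((7 * (N : ℝ)) / 8)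
    refine Nat.cast_le (α := ℝ).1 (le_trans ?_ h1)
    linarith
  let v : (Fin N → ℝ) → X →ₗ[ℝ] Y := fun η =>
    ∑ i, (η i * d i) • ((LinearMap.proj i ∘ₗ A).smulRight (b i))
  have hv : ∀ η x, v η x = ∑ i, (η i * (d i * A x i)) • b i := fun η x => by
    simp only [v, LinearMap.sum_apply, LinearMap.smul_apply, LinearMap.smulRight_apply,
      LinearMap.comp_apply, LinearMap.proj_apply, smul_smul, mul_assoc]
  have hsplit : u = v θ + v fun i => 1 - θ i := by
    ext x
    rw [LinearMap.add_apply, hux, hv, hv, ← Finset.sum_add_distrib]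
    refine Finset.sum_congr rfl fun i _ => ?_
    rw [← add_smul]
    congr 1
    ring
  have hexp : ∀ f : StrongDual ℝ Y, ∑ i, (2 * θ i - 1) * |f (b i)| ^ p =
      2 * ∑ i, θ i * |f (b i)| ^ p - ∑ i, |f (b i)| ^ p := fun f => by
    rw [Finset.mul_sum, ← Finset.sum_sub_distrib]
    exact Finset.sum_congr rfl fun i _ => by ring
  have h1 := nuQ_weighted_le (k := ⌈(7 * (N : ℝ)) / 8⌉₊) (s := (1 + δ) / 2) hpq (v θ) A d b θ
    (fun i => (hθ i).1) (hceil _ hθ0) (hv θ) hα0 hβ0 (by positivity) hα hbβ fun f => by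
      have := (abs_le.1 (hθb f)).2
      rw [hexp] at this
      linarith
  have h2 := nuQ_weighted_le (k := ⌈(7 * (N : ℝ)) / 8⌉₊) (s := (1 + δ) / 2) hpq
    (v fun i => 1 - θ i) A d b (fun i => 1 - θ i) (fun i => sub_nonneg.2 (hθ i).2)
    (by
      have e : (Finset.univ.filter fun i => 1 - θ i ≠ 0) =
          Finset.univ.filter fun i => θ i ≠ 1 :=
        Finset.filter_congr fun i _ => by rw [sub_ne_zero, ne_comm]
      rw [e]
      exact hceil _ hθ1)
    (hv _) hα0 hβ0 (by positivity) hα hbβ fun f => by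
      have := (abs_le.1 (hθb f)).1
      rw [hexp] at this
      simp only [sub_mul, one_mul, Finset.sum_sub_distrib]
      linarith
  have h3 := add_rpow_inv_le hpq (a := ∑ i, θ i * |d i| ^ q)
    (b := ∑ i, (1 - θ i) * |d i| ^ q)
    (Finset.sum_nonneg fun i _ => mul_nonneg (hθ i).1 (by positivity))
    (Finset.sum_nonneg fun i _ => mul_nonneg (sub_nonneg.2 (hθ i).2) (by positivity))
  rw [← Finset.sum_add_distrib] at h3
  simp only [← add_mul, add_sub_cancel, one_mul] at h3
  have hp1 : 1 / p ≤ 1 := by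
    rw [div_le_one (by linarith)]
    linarith
  have h4 : (2 : ℝ) ^ (1 / p) * ((1 + δ) / 2) ^ (1 / p) ≤ 1 + δ := by
    rw [← Real.mul_rpow two_pos.le (by positivity), mul_div_cancel₀ _ two_ne_zero]
    exact Real.rpow_le_self_of_one_le (by linarith) hp1
  have hD0 : 0 ≤ (∑ i, |d i| ^ q) ^ (1 / q) := by positivity
  calc nuQSplit q ⌈(7 * (N : ℝ)) / 8⌉₊ 2 u
      ≤ _ := nuQSplit_two_le q _ u _ _ hsplit
    _ ≤ _ := add_le_add h1 h2
    _ = α * (((1 + δ) / 2) ^ (1 / p) * β) * ((∑ i, θ i * |d i| ^ q) ^ (1 / q) +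
        (∑ i, (1 - θ i) * |d i| ^ q) ^ (1 / q)) := by ring
    _ ≤ α * (((1 + δ) / 2) ^ (1 / p) * β) *
        ((2 : ℝ) ^ (1 / p) * (∑ i, |d i| ^ q) ^ (1 / q)) := by gcongr
    _ = ((2 : ℝ) ^ (1 / p) * ((1 + δ) / 2) ^ (1 / p)) *
        (α * (∑ i, |d i| ^ q) ^ (1 / q) * β) := by ring
    _ ≤ (1 + δ) * (α * D * β) := by gcongr

end nuQ

/-- Proposition 3.1 (ii): for `2 < p < ∞`, `q = p/(p-1)`, `2 ≤ n ≤ N` and an operator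
`u : X → Y` with `X` finite dimensional and `dim Y ≤ n`,
`ν_q^{(⌈7N/8⌉,2)}(u) ≤ (1 + C_p (n^{p/2}/N)^{1/2} (log n) (log N)^{1/2}) · ν_q^{(N,1)}(u)`
where `C_p = C p^2 2^{p/2}` with `C` an absolute constant. -/
theorem nuQ_split_bound_two_lt_p :
    ∃ C : ℝ, 0 < C ∧
      ∀ (p : ℝ), 2 < p →
      ∀ (n N : ℕ), 2 ≤ n → n ≤ N →
      ∀ (X Y : Type) [NormedAddCommGroup X] [NormedSpace ℝ X]
        [NormedAddCommGroup Y] [NormedSpace ℝ Y],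
      FiniteDimensional ℝ X → FiniteDimensional ℝ Y → Module.finrank ℝ Y ≤ n →
      ∀ (u : X →ₗ[ℝ] Y),
        nuQSplit (p / (p - 1)) ⌈(7 * (N : ℝ)) / 8⌉₊ 2 u ≤
          (1 + C * p ^ 2 * (2 : ℝ) ^ (p / 2) * Real.sqrt ((n : ℝ) ^ (p / 2) / N) *
              Real.log n * Real.sqrt (Real.log N)) *
            nuQSplit (p / (p - 1)) N 1 u := by
  refine ⟨300, by norm_num, ?_⟩
  intro p hp n N hn hnN X Y _ _ _ _ hX hY hfin u
  have hpq : p.HolderConjugate (p / (p - 1)) := Real.HolderConjugate.conjExponent (by linarith)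
  have hlog := Real.log_natCast_nonneg n
  have hp0 : 0 < p := by linarith
  have hconst : 300 * p * √((n : ℝ) ^ (p / 2) / N) * Real.log n * √(Real.log N) ≤
      300 * p ^ 2 * (2 : ℝ) ^ (p / 2) * √((n : ℝ) ^ (p / 2) / N) * Real.log n *
        √(Real.log N) := by
    have h1 : p ≤ p ^ 2 * (2 : ℝ) ^ (p / 2) := by
      have : (1 : ℝ) ≤ (2 : ℝ) ^ (p / 2) :=
        Real.one_le_rpow one_le_two (by linarith)
      nlinarith
    have h2 : 300 * p ≤ 300 * p ^ 2 * (2 : ℝ) ^ (p / 2) := by linarith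
    gcongr
  refine le_trans ?_ (mul_le_mul_of_nonneg_right (add_le_add_right hconst 1)
    (by rw [nuQSplit_one]; exact nuQ_nonneg _ _ _))
  have hδ : 0 < 1 + 300 * p * √((n : ℝ) ^ (p / 2) / N) * Real.log n * √(Real.log N) := by
    positivity
  rw [nuQSplit_one, ← div_le_iff₀' hδ]
  obtain ⟨A, B, hAB⟩ := exists_factorization (hfin.trans hnN) u
  refine le_csInf ⟨_, A, fun _ => 1, B, hAB, rfl⟩ ?_
  rintro _ ⟨A, d, B, hu, rfl⟩
  rw [div_le_iff₀' hδ]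
  exact nuQSplit_two_le_of_factorization hfin hp hpq hn hnN u A d B hu
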